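/- Under the standing assumptions, the four-point function satisfies a Wick-type bound: there exist a constant c(d) and η ∈ [0, 1) such that for all δ ∈ (0, 1] and all distinct z₁, z₂, z₃, z₄ ∈ ∂((1−δ)𝔹), |k₄(z₁, z₂, z₃, z₄)| ≤ c(d) δ^{−η} [G^𝔹(z₁,z₂)G^𝔹(z₃,z₄) + G^𝔹(z₁,z₃)G^𝔹(z₂,z₄) + G^𝔹(z₁,z₄)G^𝔹(z₂,z₃)]. -/

import Mathlib

open MeasureTheory ProbabilityTheory Metric Filter Topology Set

noncomputable section

abbrev Euc (d : ℕ) : Type := EuclideanSpace ℝ (Fin d)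

/-- The scaling function `s`: `s(r) = -log r` if `d = 2`, and `s(r) = r^(2-d)` if `d ≥ 3`. -/
noncomputable def sFun (d : ℕ) (r : ℝ) : ℝ :=
  if d = 2 then -Real.log r else r ^ ((2 : ℝ) - (d : ℝ))

open Classical in
/-- The zero boundary Green's function of the open unit ball in `ℝ^d`:
`G(x,y) = s(|x-y|) - s(|x|·|y - x/|x|²|)`, interpreted by continuity at `x = 0`. -/
noncomputable def greenBall (d : ℕ) (x y : Euc d) : ℝ :=
  if x = 0 then sFun d ‖y‖ - sFun d 1
  else sFun d ‖x - y‖ - sFun d (‖x‖ * ‖y - (‖x‖ ^ 2)⁻¹ • x‖)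

/-- Smooth compactly supported test functions. -/
def IsTestFun {d : ℕ} (f : Euc d → ℝ) : Prop :=
  ContDiff ℝ (⊤ : ℕ∞) f ∧ HasCompactSupport f

/-- The Laplacian of `u : ℝ^d → ℝ` at `x`, as the sum of pure second derivatives in the
coordinate directions. -/
noncomputable def lap {d : ℕ} (u : Euc d → ℝ) (x : Euc d) : ℝ :=
  ∑ i : Fin d, iteratedFDeriv ℝ 2 u x ![EuclideanSpace.single i 1, EuclideanSpace.single i 1]

/-- A function is harmonic on a set if it is twice continuously differentiable there with
vanishing Laplacian. -/
def IsHarmonicOn {d : ℕ} (u : Euc d → ℝ) (s : Set (Euc d)) : Prop :=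
  ContDiffOn ℝ 2 u s ∧ ∀ x ∈ s, lap u x = 0

/-- A real random variable is a (possibly degenerate) centered Gaussian. -/
def IsCenteredGaussianRV {Ω : Type} [MeasurableSpace Ω] (P : Measure Ω) (Y : Ω → ℝ) : Prop :=
  ∃ v : NNReal, Measure.map Y P = ProbabilityTheory.gaussianReal 0 v

/-- The standing assumptions: a collection of stochastic processes `h a r` (thought of as
`h^{a + r𝔹}`) indexed by test functions, which is centered, a.s. linear, zero outside the ball,
translation/scaling covariant, satisfies the domain Markov property (with the decomposition
recorded as data `H`, `Φ`, `φharm`), has fourth moments, a (sequentially) continuous covariance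
bilinear form on `C_c^∞(𝔹)`, and zero boundary conditions. -/
structure GFF (d : ℕ) (Ω : Type) [MeasurableSpace Ω] where
  P : Measure Ω
  prob : IsProbabilityMeasure P
  /-- the field `h^{a+r𝔹}` tested against `f` -/
  h : Euc d → ℝ → (Euc d → ℝ) → Ω → ℝ
  meas_h : ∀ a r f, Measurable (h a r f)
  integrable_h : ∀ a r f, IsTestFun f → Integrable (h a r f) P
  /-- centered -/
  centered : ∀ a r f, IsTestFun f → ∫ ω, h a r f ω ∂P = 0
  /-- (1) a.s. linearity in the test function -/
  lin_add : ∀ f g : Euc d → ℝ, IsTestFun f → IsTestFun g →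
    ∀ᵐ ω ∂P, h 0 1 (f + g) ω = h 0 1 f ω + h 0 1 g ω
  lin_smul : ∀ (c : ℝ) (f : Euc d → ℝ), IsTestFun f →
    ∀ᵐ ω ∂P, h 0 1 (c • f) ω = c * h 0 1 f ω
  /-- (2) the field vanishes on test functions supported outside the ball -/
  zero_outside : ∀ f : Euc d → ℝ, IsTestFun f → tsupport f ⊆ (ball (0 : Euc d) 1)ᶜ →
    ∀ᵐ ω ∂P, h 0 1 f ω = 0
  /-- (3) translation and scaling: `(h^{a+r𝔹}, f((·-a)/r)) = r^{1+d/2} (h^𝔹, f)` in law,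
  as processes (equality of finite dimensional distributions) -/
  scaling : ∀ (a : Euc d) (r : ℝ), 0 < r → ∀ (k : ℕ) (f : Fin k → Euc d → ℝ),
    (∀ i, IsTestFun (f i)) →
    Measure.map (fun ω (i : Fin k) => h a r (fun x => f i (r⁻¹ • (x - a))) ω) P
      = Measure.map (fun ω (i : Fin k) => r ^ (1 + (d : ℝ) / 2) * h 0 1 (f i) ω) P
  /-- (4) domain Markov property: the decomposition data. `H a r` is the independent copy of
  `h^{a+r𝔹}`, `Φ a r` is the harmonic part as a process, `φharm a r ω` is the harmonic function. -/
  H : Euc d → ℝ → (Euc d → ℝ) → Ω → ℝ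
  Φ : Euc d → ℝ → (Euc d → ℝ) → Ω → ℝ
  φharm : Euc d → ℝ → Ω → Euc d → ℝ
  meas_H : ∀ a r f, Measurable (H a r f)
  meas_Φ : ∀ a r f, Measurable (Φ a r f)
  meas_φharm : ∀ a r z, Measurable fun ω => φharm a r ω z
  dmp_decomp : ∀ (a : Euc d) (r : ℝ), 0 < r → ball a r ⊆ ball (0 : Euc d) 1 →
    ∀ f : Euc d → ℝ, IsTestFun f → ∀ᵐ ω ∂P, h 0 1 f ω = H a r f ω + Φ a r f ω
  dmp_indep : ∀ (a : Euc d) (r : ℝ), 0 < r → ball a r ⊆ ball (0 : Euc d) 1 →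
    ProbabilityTheory.Indep
      (⨆ f : {f : Euc d → ℝ // IsTestFun f}, MeasurableSpace.comap (H a r f.1) inferInstance)
      ((⨆ f : {f : Euc d → ℝ // IsTestFun f}, MeasurableSpace.comap (Φ a r f.1) inferInstance) ⊔
        (⨆ z : Euc d, MeasurableSpace.comap (fun ω => φharm a r ω z) inferInstance)) P
  dmp_law : ∀ (a : Euc d) (r : ℝ), 0 < r → ball a r ⊆ ball (0 : Euc d) 1 →
    ∀ (k : ℕ) (f : Fin k → Euc d → ℝ), (∀ i, IsTestFun (f i)) →
    Measure.map (fun ω (i : Fin k) => H a r (f i) ω) P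
      = Measure.map (fun ω (i : Fin k) => h a r (f i) ω) P
  dmp_harm : ∀ (a : Euc d) (r : ℝ), 0 < r → ball a r ⊆ ball (0 : Euc d) 1 →
    ∀ᵐ ω ∂P, IsHarmonicOn (φharm a r ω) (ball a r) ∧
      ∀ f : Euc d → ℝ, IsTestFun f → tsupport f ⊆ ball a r →
        Φ a r f ω = ∫ x in ball a r, φharm a r ω x * f x
  /-- (5) fourth moments -/
  mom4 : ∀ f : Euc d → ℝ, IsTestFun f → Integrable (fun ω => (h 0 1 f ω) ^ 4) P
  /-- (6) sequential continuity of the covariance bilinear form on `C_c^∞(𝔹)` -/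
  K2_cont : ∀ (f : ℕ → Euc d → ℝ) (f₀ g : Euc d → ℝ) (K : Set (Euc d)),
    IsCompact K → K ⊆ ball (0 : Euc d) 1 →
    (∀ n, IsTestFun (f n)) → IsTestFun f₀ → IsTestFun g → tsupport g ⊆ ball (0 : Euc d) 1 →
    (∀ n, tsupport (f n) ⊆ K) → tsupport f₀ ⊆ K →
    (∀ m : ℕ, TendstoUniformly (fun n => iteratedFDeriv ℝ m (f n)) (iteratedFDeriv ℝ m f₀) atTop) →
    Tendsto (fun n => ∫ ω, h 0 1 (f n) ω * h 0 1 g ω ∂P) atTop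
      (𝓝 (∫ ω, h 0 1 f₀ ω * h 0 1 g ω ∂P))
  /-- (7) zero boundary conditions -/
  zero_bdry : ∀ f : ℕ → Euc d → ℝ,
    (∀ n, IsTestFun (f n)) → (∀ n x, 0 ≤ f n x) →
    (∃ C : ℝ, ∀ n, ∫ x, f n x ≤ C) →
    Tendsto (fun n => Metric.infDist (0 : Euc d) (tsupport (f n))) atTop (𝓝 1) →
    (∃ C : ℝ, ∀ (n : ℕ) (x y : Euc d), ‖x‖ = ‖y‖ → ‖x‖ < 1 → f n x ≤ C * f n y) →
    Tendsto (fun n => ∫ ω, (h 0 1 (f n) ω) ^ 2 ∂P) atTop (𝓝 0)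

instance {d : ℕ} {Ω : Type} [MeasurableSpace Ω] (X : GFF d Ω) : IsProbabilityMeasure X.P :=
  X.prob

/-- A valid choice of radii in the definition of the four-point function. -/
noncomputable def k4eps {d : ℕ} (z : Fin 4 → Euc d) (i : Fin 4) : ℝ :=
  min ((⨅ j : {j : Fin 4 // j ≠ i}, dist (z i) (z j.1)) / 2) (1 - ‖z i‖) / 2

/-- The four-point function `k₄(z₁,...,z₄) = E[∏ᵢ φ^{zᵢ+aᵢ𝔹}_𝔹(zᵢ)]`
(independent of the admissible choices of `aᵢ`, under the standing assumptions). -/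
noncomputable def GFF.k4 {d : ℕ} {Ω : Type} [MeasurableSpace Ω] (X : GFF d Ω) (z : Fin 4 → Euc d) : ℝ :=
  ∫ ω, ∏ i, X.φharm (z i) (k4eps z i) ω (z i) ∂X.P

section

open scoped ContDiff

variable {d : ℕ}

/-- The partial derivative of `u` in the `i`-th coordinate direction. -/
def pd {d : ℕ} (i : Fin d) (u : Euc d → ℝ) (x : Euc d) : ℝ :=
  fderiv ℝ u x (EuclideanSpace.single i 1)


theorem lap_eq_sum_pd {u : Euc d → ℝ} {x : Euc d} (hu : ContDiffAt ℝ 2 u x) :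
    lap u x = ∑ i, pd i (pd i u) x := by
  unfold lap pd
  refine Finset.sum_congr rfl fun i _ => ?_
  have h1 : DifferentiableAt ℝ (fderiv ℝ u) x :=
    (hu.fderiv_right (m := 1) (by norm_num)).differentiableAt (by norm_num)
  rw [iteratedFDeriv_two_apply, fderiv_clm_apply h1 (differentiableAt_const _)]
  simp

theorem ContDiff.pd {u : Euc d → ℝ} (hu : ContDiff ℝ ∞ u) (i : Fin d) : ContDiff ℝ ∞ (pd i u) :=
  (hu.fderiv_right (m := ∞) (by simp)).clm_apply contDiff_const

theorem lap_eq_sum_pd' {u : Euc d → ℝ} (hu : ContDiff ℝ ∞ u) :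
    lap u = fun x => ∑ i, pd i (pd i u) x :=
  funext fun _ => lap_eq_sum_pd (hu.of_le (by norm_cast)).contDiffAt

theorem ContDiff.lap {u : Euc d → ℝ} (hu : ContDiff ℝ ∞ u) : ContDiff ℝ ∞ (lap u) := by
  rw [lap_eq_sum_pd' hu]
  exact ContDiff.sum fun i _ => (hu.pd i).pd i

theorem lap_congr_nhds {u v : Euc d → ℝ} {x : Euc d} (h : u =ᶠ[𝓝 x] v) : lap u x = lap v x := by
  unfold lap
  rw [(h.iteratedFDeriv ℝ 2).eq_of_nhds]

theorem lap_const (c : ℝ) : lap (fun _ : Euc d => c) = 0 := by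
  funext x
  simp [lap, iteratedFDeriv_const_of_ne (two_ne_zero)]

theorem lap_eq_zero_of_notMem_tsupport {u : Euc d → ℝ} {x : Euc d} (h : x ∉ tsupport u) :
    lap u x = 0 := by
  rw [lap_congr_nhds (notMem_tsupport_iff_eventuallyEq.mp h)]
  exact congrFun (lap_const 0) x

theorem tsupport_lap_subset (u : Euc d → ℝ) : tsupport (lap u) ⊆ tsupport u :=
  closure_minimal (fun x hx => by
    by_contra h
    exact hx (lap_eq_zero_of_notMem_tsupport h)) (isClosed_tsupport u)

theorem IsTestFun.lap {u : Euc d → ℝ} (hu : IsTestFun u) : IsTestFun (lap u) :=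
  ⟨ContDiff.lap hu.1, hu.2.of_isClosed_subset (isClosed_tsupport _) (tsupport_lap_subset u)⟩

theorem IsTestFun.add {u v : Euc d → ℝ} (hu : IsTestFun u) (hv : IsTestFun v) :
    IsTestFun (u + v) :=
  ⟨hu.1.add hv.1, hu.2.add hv.2⟩

theorem IsTestFun.smul {u : Euc d → ℝ} (hu : IsTestFun u) (c : ℝ) : IsTestFun (c • u) :=
  ⟨contDiff_const.smul hu.1, hu.2.smul_left (f := fun _ => c)⟩

theorem IsTestFun.sub {u v : Euc d → ℝ} (hu : IsTestFun u) (hv : IsTestFun v) :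
    IsTestFun (u - v) := by
  have := hu.add (hv.smul (-1))
  rwa [neg_one_smul, ← sub_eq_add_neg] at this

theorem pd_add {u v : Euc d → ℝ} (hu : ContDiff ℝ ∞ u) (hv : ContDiff ℝ ∞ v) (i : Fin d) :
    pd i (u + v) = pd i u + pd i v := by
  funext x
  simp only [pd, Pi.add_apply]
  rw [fderiv_add (hu.differentiable (by simp) x) (hv.differentiable (by simp) x)]
  rfl

theorem pd_smul {u : Euc d → ℝ} (hu : ContDiff ℝ ∞ u) (c : ℝ) (i : Fin d) :
    pd i (c • u) = c • pd i u := by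
  funext x
  simp only [pd, Pi.smul_apply]
  rw [fderiv_const_smul (hu.differentiable (by simp) x)]
  rfl

theorem pd_mul {u v : Euc d → ℝ} (hu : ContDiff ℝ ∞ u) (hv : ContDiff ℝ ∞ v) (i : Fin d) :
    pd i (u * v) = u * pd i v + v * pd i u := by
  funext x
  simp only [pd, Pi.add_apply, Pi.mul_apply]
  rw [fderiv_mul (hu.differentiable (by simp) x) (hv.differentiable (by simp) x)]
  rfl

theorem lap_add {u v : Euc d → ℝ} (hu : ContDiff ℝ ∞ u) (hv : ContDiff ℝ ∞ v) :
    lap (u + v) = lap u + lap v := by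
  rw [lap_eq_sum_pd' hu, lap_eq_sum_pd' hv, lap_eq_sum_pd' (u := u + v) (hu.add hv)]
  funext x
  simp only [Pi.add_apply, ← Finset.sum_add_distrib]
  refine Finset.sum_congr rfl fun i _ => ?_
  rw [pd_add hu hv, pd_add (hu.pd i) (hv.pd i)]
  rfl

theorem lap_smul {u : Euc d → ℝ} (hu : ContDiff ℝ ∞ u) (c : ℝ) : lap (c • u) = c • lap u := by
  rw [lap_eq_sum_pd' hu, lap_eq_sum_pd' (u := c • u) (hu.const_smul c)]
  funext x
  simp only [Pi.smul_apply, Finset.smul_sum]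
  refine Finset.sum_congr rfl fun i _ => ?_
  rw [pd_smul hu, pd_smul (hu.pd i)]
  rfl

theorem lap_sub {u v : Euc d → ℝ} (hu : ContDiff ℝ ∞ u) (hv : ContDiff ℝ ∞ v) :
    lap (u - v) = lap u - lap v := by
  have h := lap_add hu (v := (-1 : ℝ) • v) (hv.const_smul (-1 : ℝ))
  rw [lap_smul hv] at h
  simpa [← sub_eq_add_neg] using h

theorem lap_mul {u v : Euc d → ℝ} (hu : ContDiff ℝ ∞ u) (hv : ContDiff ℝ ∞ v) (x : Euc d) :
    lap (u * v) x = u x * lap v x + 2 * ∑ i, pd i u x * pd i v x + v x * lap u x := by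
  rw [lap_eq_sum_pd' hu, lap_eq_sum_pd' hv, lap_eq_sum_pd' (u := u * v) (hu.mul hv), Finset.mul_sum,
    Finset.mul_sum, Finset.mul_sum, ← Finset.sum_add_distrib, ← Finset.sum_add_distrib]
  refine Finset.sum_congr rfl fun i _ => ?_
  rw [pd_mul hu hv, pd_add (u := u * pd i v) (v := v * pd i u) (hu.mul (hv.pd i)) (hv.mul (hu.pd i)), pd_mul hu (hv.pd i),
    pd_mul hv (hu.pd i)]
  simp only [Pi.add_apply, Pi.mul_apply]
  ring

theorem pd_comp_affine {u : Euc d → ℝ} (hu : ContDiff ℝ ∞ u) (c : ℝ) (b : Euc d) (i : Fin d) :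
    pd i (fun x => u (c • x + b)) = c • fun x => pd i u (c • x + b) := by
  funext x
  have h : HasFDerivAt (fun x : Euc d => c • x + b) (c • ContinuousLinearMap.id ℝ (Euc d)) x :=
    ((hasFDerivAt_id x).const_smul c).add_const b
  have h2 := ((hu.differentiable (by simp) (c • x + b)).hasFDerivAt).comp x h
  have h3 : fderiv ℝ (fun x => u (c • x + b)) x = _ := h2.fderiv
  simp [pd, h3]

theorem lap_comp_affine {u : Euc d → ℝ} (hu : ContDiff ℝ ∞ u) (c : ℝ) (b : Euc d) (x : Euc d) :
    lap (fun x => u (c • x + b)) x = c ^ 2 * lap u (c • x + b) := by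
  have haff : ContDiff ℝ ∞ fun x : Euc d => c • x + b :=
    (contDiff_id.const_smul c).add contDiff_const
  rw [lap_eq_sum_pd' (u := fun x => u (c • x + b)) (hu.comp haff), lap_eq_sum_pd' hu,
    Finset.mul_sum]
  refine Finset.sum_congr rfl fun i _ => ?_
  rw [pd_comp_affine hu, pd_smul (u := fun x => pd i u (c • x + b)) ((hu.pd i).comp haff),
    pd_comp_affine (hu.pd i)]
  simp only [Pi.smul_apply, smul_eq_mul]
  ring

/-- The quadratic polynomial `α |x|² - 2 ⟨b, x⟩ + γ`. -/
def quad (α γ : ℝ) (b x : Euc d) : ℝ := α * ‖x‖ ^ 2 - 2 * inner ℝ b x + γ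

theorem contDiff_quad (α γ : ℝ) (b : Euc d) : ContDiff ℝ ∞ (quad α γ b) :=
  ((contDiff_const.mul (contDiff_norm_sq ℝ)).sub
    (contDiff_const.mul (contDiff_const.inner ℝ contDiff_id))).add contDiff_const

theorem pd_comp_quad {F : ℝ → ℝ} (hF : ContDiff ℝ ∞ F) (α γ : ℝ) (b : Euc d) (i : Fin d) :
    pd i (fun x => F (quad α γ b x)) =
      fun x => deriv F (quad α γ b x) * (2 * (α * x i - b i)) := by
  funext x
  have h1 : HasFDerivAt (fun x : Euc d => ‖x‖ ^ 2) _ x := (hasStrictFDerivAt_norm_sq x).hasFDerivAt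
  have h2 : HasFDerivAt (fun x : Euc d => inner ℝ b x) (innerSL ℝ b) x := (innerSL ℝ b).hasFDerivAt
  have h3 : HasFDerivAt (quad α γ b) _ x := ((h1.const_mul α).sub (h2.const_mul 2)).add_const γ
  have h4 := ((hF.differentiable (by simp) (quad α γ b x)).hasDerivAt).comp_hasFDerivAt x h3
  have h5 : fderiv ℝ (fun x => F (quad α γ b x)) x = _ := h4.fderiv
  simp only [pd, h5]
  simp [EuclideanSpace.inner_single_right]
  left; ring

theorem pd_coord (i j : Fin d) (α β : ℝ) :
    pd i (fun x : Euc d => α * x j - β) = fun _ => if i = j then α else 0 := by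
  funext x
  have h1 : HasFDerivAt (fun x : Euc d => x j) (EuclideanSpace.proj (𝕜 := ℝ) j) x :=
    (EuclideanSpace.proj (𝕜 := ℝ) j).hasFDerivAt
  have h2 := ((h1.const_mul α).sub_const β).fderiv
  simp only [pd, h2]
  by_cases h : i = j
  · subst h; simp
  · simp [h, Ne.symm h]

theorem lap_comp_quad {F : ℝ → ℝ} (hF : ContDiff ℝ ∞ F) (α γ : ℝ) (b x : Euc d) :
    lap (fun x => F (quad α γ b x)) x =
      4 * ‖α • x - b‖ ^ 2 * deriv (deriv F) (quad α γ b x) +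
        2 * d * α * deriv F (quad α γ b x) := by
  have hF' : ContDiff ℝ ∞ (deriv F) := (contDiff_infty_iff_deriv.mp hF).2
  have hc : ∀ i : Fin d, ContDiff ℝ ∞ (fun x : Euc d => 2 * α * x i - 2 * b i) := fun i =>
    (contDiff_const.mul (EuclideanSpace.proj (𝕜 := ℝ) i).contDiff).sub contDiff_const
  rw [lap_eq_sum_pd' (u := fun x => F (quad α γ b x)) (hF.comp (contDiff_quad α γ b)), EuclideanSpace.norm_sq_eq]
  have h : ∀ i, pd i (pd i (fun x => F (quad α γ b x))) x =
      4 * (α * x i - b i) ^ 2 * deriv (deriv F) (quad α γ b x) +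
        2 * α * deriv F (quad α γ b x) := fun i => by
    have h1 : pd i (fun x => F (quad α γ b x)) =
        (fun x => deriv F (quad α γ b x)) * fun x => 2 * α * x i - 2 * b i := by
      rw [pd_comp_quad hF]; funext x; simp only [Pi.mul_apply]; ring
    rw [h1, pd_mul (u := fun x => deriv F (quad α γ b x)) (hF'.comp (contDiff_quad α γ b)) (hc i)]
    simp only [Pi.add_apply, Pi.mul_apply]
    rw [pd_comp_quad hF', pd_coord]
    simp only [if_true]; ring
  simp only [h]
  rw [Finset.sum_add_distrib, ← Finset.sum_mul, ← Finset.mul_sum]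
  simp
  ring

theorem integral_pd_eq_zero {V : Euc d → ℝ} (hV : ContDiff ℝ 1 V) (hc : HasCompactSupport V)
    (i : Fin d) : ∫ x, pd i V x = 0 := by
  have hd : Differentiable ℝ V := hV.differentiable (by simp)
  have hc' : HasCompactSupport fun x => fderiv ℝ V x (EuclideanSpace.single i 1) :=
    (hc.fderiv ℝ).comp_left (g := fun L : Euc d →L[ℝ] ℝ => L (EuclideanSpace.single i 1)) rfl
  have hcont : Continuous fun x => fderiv ℝ V x (EuclideanSpace.single i 1) :=
    (hV.continuous_fderiv (by simp)).clm_apply continuous_const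
  have h := integral_mul_fderiv_eq_neg_fderiv_mul_of_integrable (𝕜 := ℝ) (μ := volume)
    (f := fun _ : Euc d => (1 : ℝ)) (g := V) (v := EuclideanSpace.single i 1)
    (by simp) (by simpa using hcont.integrable_of_hasCompactSupport hc')
    (by simpa using hV.continuous.integrable_of_hasCompactSupport hc)
    (fun _ _ => differentiableAt_const _) (fun x _ => hd x)
  simpa [pd] using h

theorem pd_congr_nhds {u v : Euc d → ℝ} {x : Euc d} (h : u =ᶠ[𝓝 x] v) (i : Fin d) :
    pd i u x = pd i v x := by
  unfold pd
  rw [h.fderiv_eq]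

theorem pd_mul_at {u v : Euc d → ℝ} {x : Euc d} (hu : DifferentiableAt ℝ u x)
    (hv : DifferentiableAt ℝ v x) (i : Fin d) :
    pd i (fun x => u x * v x) x = u x * pd i v x + v x * pd i u x := by
  simp only [pd]
  rw [fderiv_fun_mul hu hv]
  rfl

/-- Green's identity against a harmonic function. -/
theorem IsHarmonicOn.integral_mul_lap {u g : Euc d → ℝ} {D : Set (Euc d)} (hD : IsOpen D)
    (hu : IsHarmonicOn u D) (hg : IsTestFun g) (hgD : tsupport g ⊆ D) :
    ∫ x in D, u x * lap g x = 0 := by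
  have huD : ∀ x ∈ D, ContDiffAt ℝ 2 u x := fun x hx => hu.1.contDiffAt (hD.mem_nhds hx)
  have hpu : ∀ x ∈ D, ∀ i, ContDiffAt ℝ 1 (pd i u) x := fun x hx i =>
    ((huD x hx).fderiv_right (m := 1) (by norm_num)).clm_apply contDiffAt_const
  set V : Fin d → Euc d → ℝ := fun i x => u x * pd i g x - g x * pd i u x with hV
  have hVz : ∀ i x, x ∉ tsupport g → V i =ᶠ[𝓝 x] fun _ => 0 := fun i x hx => by
    have h0 := (isClosed_tsupport g).isOpen_compl.mem_nhds hx
    filter_upwards [h0] with y hy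
    have hy' := notMem_tsupport_iff_eventuallyEq.mp hy
    have h1 : pd i g y = 0 := by
      rw [pd_congr_nhds hy']; simp [pd]
    simp [hV, h1, hy'.eq_of_nhds]
  have hVc : ∀ i, ContDiff ℝ 1 (V i) := fun i => by
    rw [contDiff_iff_contDiffAt]
    intro x
    by_cases hx : x ∈ tsupport g
    · have hx' := hgD hx
      exact (((huD x hx').of_le (by norm_num)).mul
        ((hg.1.pd i).of_le (by norm_cast)).contDiffAt).sub
          ((hg.1.of_le (by norm_cast)).contDiffAt.mul (hpu x hx' i))
    · exact contDiffAt_const.congr_of_eventuallyEq (hVz i x hx)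
  have hVs : ∀ i, HasCompactSupport (V i) := fun i =>
    HasCompactSupport.intro hg.2.isCompact fun x hx => (hVz i x hx).eq_of_nhds
  have hsum : ∀ x ∈ D, u x * lap g x = ∑ i, pd i (V i) x := fun x hx => by
    have h1 : ∀ i, pd i (V i) x = u x * pd i (pd i g) x - g x * pd i (pd i u) x := fun i => by
      have hdu : DifferentiableAt ℝ u x := (huD x hx).differentiableAt (by norm_num)
      have hdg : DifferentiableAt ℝ g x := hg.1.differentiable (by simp) x
      have hdpg : DifferentiableAt ℝ (pd i g) x := (hg.1.pd i).differentiable (by simp) x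
      have hdpu : DifferentiableAt ℝ (pd i u) x := (hpu x hx i).differentiableAt (by norm_num)
      have : pd i (V i) x = pd i (fun x => u x * pd i g x) x - pd i (fun x => g x * pd i u x) x := by
        simp only [pd, hV]
        rw [fderiv_fun_sub]
        · rfl
        · exact hdu.mul hdpg
        · exact hdg.mul hdpu
      rw [this, pd_mul_at hdu hdpg, pd_mul_at hdg hdpu]
      ring
    simp only [h1, Finset.sum_sub_distrib, ← Finset.mul_sum]
    rw [← lap_eq_sum_pd (huD x hx), hu.2 x hx, lap_eq_sum_pd' hg.1]
    ring
  have hsupp : ∀ x ∉ D, ∑ i, pd i (V i) x = 0 := fun x hx => by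
    refine Finset.sum_eq_zero fun i _ => ?_
    rw [pd_congr_nhds (hVz i x fun h => hx (hgD h))]
    simp [pd]
  rw [setIntegral_congr_fun hD.measurableSet hsum,
    setIntegral_eq_integral_of_forall_compl_eq_zero hsupp, integral_finsetSum]
  · exact Finset.sum_eq_zero fun i _ => integral_pd_eq_zero (hVc i) (hVs i) i
  · intro i _
    refine Continuous.integrable_of_hasCompactSupport
      (((hVc i).continuous_fderiv (by simp)).clm_apply continuous_const) ?_
    exact ((hVs i).fderiv ℝ).comp_left
      (g := fun L : Euc d →L[ℝ] ℝ => L (EuclideanSpace.single i 1)) rfl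

theorem isHarmonicOn_const (c : ℝ) (D : Set (Euc d)) : IsHarmonicOn (fun _ => c) D :=
  ⟨contDiffOn_const, fun x _ => congrFun (lap_const c) x⟩

theorem integral_lap {g : Euc d → ℝ} (hg : IsTestFun g) : ∫ x, lap g x = 0 := by
  simpa using (isHarmonicOn_const (d := d) 1 univ).integral_mul_lap isOpen_univ hg (subset_univ _)

/-- A smooth cutoff: `0` for `t ≤ ε²/2` and `1` for `t ≥ ε²`. -/
def radCut (ε t : ℝ) : ℝ := Real.smoothTransition (2 * t / ε ^ 2 - 1)

theorem contDiff_radCut (ε : ℝ) : ContDiff ℝ ∞ (radCut ε) :=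
  Real.smoothTransition.contDiff.comp
    (((contDiff_const.mul contDiff_id).div_const _).sub contDiff_const)

theorem radCut_of_le {ε t : ℝ} (hε : 0 < ε) (h : t ≤ ε ^ 2 / 2) : radCut ε t = 0 := by
  refine Real.smoothTransition.zero_of_nonpos ?_
  rw [sub_nonpos, div_le_one (by positivity)]
  linarith

theorem radCut_of_ge {ε t : ℝ} (hε : 0 < ε) (h : ε ^ 2 ≤ t) : radCut ε t = 1 := by
  refine Real.smoothTransition.one_of_one_le ?_
  rw [le_sub_iff_add_le, le_div_iff₀ (by positivity)]
  linarith

theorem radCut_mono {ε : ℝ} (hε : 0 < ε) : Monotone (radCut ε) := fun s t h => by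
  refine Real.smoothTransition.monotone ?_
  gcongr

/-- The regularised radial profile `t^(-d/2)`. -/
def radE (d : ℕ) (ε t : ℝ) : ℝ := radCut ε t * t ^ (-(d : ℝ) / 2)

theorem contDiff_radE (d : ℕ) {ε : ℝ} (hε : 0 < ε) : ContDiff ℝ ∞ (radE d ε) := by
  rw [contDiff_iff_contDiffAt]
  intro t
  rcases lt_or_ge t (ε ^ 2 / 2) with h | h
  · refine (contDiffAt_const (c := (0 : ℝ))).congr_of_eventuallyEq ?_
    filter_upwards [Iio_mem_nhds h] with s hs
    simp [radE, radCut_of_le hε (le_of_lt hs)]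
  · have ht : t ≠ 0 := by
      have : 0 < ε ^ 2 / 2 := by positivity
      linarith
    exact (contDiff_radCut ε).contDiffAt.mul (Real.contDiffAt_rpow_const_of_ne ht)

/-- The primitive of `- radE`. -/
def radF (d : ℕ) (ε t : ℝ) : ℝ := -∫ s in (1 : ℝ)..t, radE d ε s

theorem deriv_radF (d : ℕ) {ε : ℝ} (hε : 0 < ε) : deriv (radF d ε) = fun t => -radE d ε t := by
  funext t
  have := (contDiff_radE d hε).continuous
  exact (intervalIntegral.integral_hasDerivAt_right (this.intervalIntegrable 1 t)
    (this.stronglyMeasurableAtFilter _ _) this.continuousAt).neg.deriv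

theorem differentiable_radF (d : ℕ) {ε : ℝ} (hε : 0 < ε) : Differentiable ℝ (radF d ε) := by
  intro t
  have := (contDiff_radE d hε).continuous
  exact (intervalIntegral.integral_hasDerivAt_right (this.intervalIntegrable 1 t)
    (this.stronglyMeasurableAtFilter _ _) this.continuousAt).neg.differentiableAt

theorem contDiff_radF (d : ℕ) {ε : ℝ} (hε : 0 < ε) : ContDiff ℝ ∞ (radF d ε) := by
  rw [contDiff_infty_iff_deriv]
  refine ⟨differentiable_radF d hε, ?_⟩
  rw [deriv_radF d hε]
  exact (contDiff_radE d hε).neg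

theorem radF_sub (d : ℕ) {ε : ℝ} (hε : 0 < ε) (a b : ℝ) :
    radF d ε a - radF d ε b = ∫ s in a..b, radE d ε s := by
  have := (contDiff_radE d hε).continuous
  have h := intervalIntegral.integral_add_adjacent_intervals (this.intervalIntegrable (μ := volume) 1 a)
    (this.intervalIntegrable a b)
  simp only [radF]
  linarith

/-- The density profile of `-Δ (radF (|x|²))`, up to the factor `4`. -/
def radB (d : ℕ) (ε t : ℝ) : ℝ :=
  -(t * deriv (deriv (radF d ε)) t + d / 2 * deriv (radF d ε) t)

theorem radB_eq (d : ℕ) {ε : ℝ} (hε : 0 < ε) {t : ℝ} (ht : 0 < t) :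
    radB d ε t = deriv (radCut ε) t * t ^ (1 - (d : ℝ) / 2) := by
  have h1 : HasDerivAt (radE d ε)
      (deriv (radCut ε) t * t ^ (-(d : ℝ) / 2) +
        radCut ε t * ((-(d : ℝ) / 2) * t ^ (-(d : ℝ) / 2 - 1))) t :=
    (((contDiff_radCut ε).differentiable (by simp) t).hasDerivAt).mul
      (Real.hasDerivAt_rpow_const (Or.inl ht.ne'))
  have h2 : deriv (fun t => -radE d ε t) t = _ := h1.neg.deriv
  rw [radB, deriv_radF d hε, h2]
  simp only [radE]
  have h3 : t ^ (-(d : ℝ) / 2) = t * t ^ (-(d : ℝ) / 2 - 1) := by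
    rw [mul_comm, ← Real.rpow_add_one ht.ne']; congr 1; ring
  have h4 : t ^ (1 - (d : ℝ) / 2) = t * t ^ (-(d : ℝ) / 2) := by
    rw [mul_comm, ← Real.rpow_add_one ht.ne']; congr 1; ring
  rw [h4, h3]
  ring

theorem deriv_radCut_of_lt {ε : ℝ} (hε : 0 < ε) {t : ℝ} (ht : t < ε ^ 2 / 2) :
    deriv (radCut ε) t = 0 := by
  have : radCut ε =ᶠ[𝓝 t] fun _ => 0 := by
    filter_upwards [Iio_mem_nhds ht] with s hs using radCut_of_le hε (le_of_lt hs)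
  rw [this.deriv_eq, deriv_const]

theorem deriv_radCut_of_gt {ε : ℝ} (hε : 0 < ε) {t : ℝ} (ht : ε ^ 2 < t) :
    deriv (radCut ε) t = 0 := by
  have : radCut ε =ᶠ[𝓝 t] fun _ => 1 := by
    filter_upwards [Ioi_mem_nhds ht] with s hs using radCut_of_ge hε (le_of_lt hs)
  rw [this.deriv_eq, deriv_const]

theorem radB_of_lt (d : ℕ) {ε : ℝ} (hε : 0 < ε) {t : ℝ} (ht : t < ε ^ 2 / 2) : radB d ε t = 0 := by
  have : deriv (radF d ε) =ᶠ[𝓝 t] fun _ => 0 := by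
    filter_upwards [Iio_mem_nhds ht] with s hs
    rw [deriv_radF d hε]
    simp [radE, radCut_of_le hε (le_of_lt hs)]
  rw [radB, this.deriv_eq, this.eq_of_nhds]
  simp

theorem radB_of_gt (d : ℕ) {ε : ℝ} (hε : 0 < ε) {t : ℝ} (ht : ε ^ 2 < t) : radB d ε t = 0 := by
  rw [radB_eq d hε (lt_trans (by positivity) ht), deriv_radCut_of_gt hε ht, zero_mul]

theorem radB_nonneg (d : ℕ) {ε : ℝ} (hε : 0 < ε) (t : ℝ) : 0 ≤ radB d ε t := by
  rcases lt_or_ge t (ε ^ 2 / 2) with h | h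
  · rw [radB_of_lt d hε h]
  · have ht : 0 < t := lt_of_lt_of_le (by positivity) h
    rw [radB_eq d hε ht]
    exact mul_nonneg ((radCut_mono hε).deriv_nonneg) (by positivity)

theorem exists_radB_ne_zero (d : ℕ) {ε : ℝ} (hε : 0 < ε) : ∃ t, 0 < t ∧ radB d ε t ≠ 0 := by
  by_contra! hcon
  have h0 : ∀ t, deriv (radCut ε) t = 0 := fun t => by
    rcases lt_or_ge t (ε ^ 2 / 2) with h | h
    · exact deriv_radCut_of_lt hε h
    · have ht : 0 < t := lt_of_lt_of_le (by positivity) h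
      have := hcon t ht
      rw [radB_eq d hε ht] at this
      exact (mul_eq_zero.mp this).resolve_right (by positivity)
  have := is_const_of_deriv_eq_zero ((contDiff_radCut ε).differentiable (by simp)) h0 0 (ε ^ 2)
  rw [radCut_of_le hε (by positivity), radCut_of_ge hε le_rfl] at this
  norm_num at this

/-- Scaling of the profile. -/
theorem radB_scale (d : ℕ) {ε r : ℝ} (hε : 0 < ε) (hr : 0 < r) {t : ℝ} (ht : 0 < t) :
    radB d (r * ε) (r ^ 2 * t) = (r ^ d)⁻¹ * radB d ε t := by
  have hcomp : radCut (r * ε) = fun t => radCut ε ((r ^ 2)⁻¹ * t) := by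
    funext t; simp only [radCut]; congr 2; field_simp
  have hder : deriv (radCut (r * ε)) (r ^ 2 * t) = (r ^ 2)⁻¹ * deriv (radCut ε) t := by
    rw [hcomp, deriv_comp_mul_left]
    simp only [smul_eq_mul]
    congr 2
    field_simp
  rw [radB_eq d (mul_pos hr hε) (by positivity), radB_eq d hε ht, hder,
    Real.mul_rpow (by positivity) ht.le]
  have : (r ^ 2) ^ (1 - (d : ℝ) / 2) = r ^ 2 * (r ^ d)⁻¹ := by
    rw [← Real.rpow_natCast r 2, ← Real.rpow_mul hr.le, ← Real.rpow_natCast r d,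
      ← Real.rpow_neg hr.le, ← Real.rpow_add hr]
    congr 1; push_cast; ring
  rw [this]
  field_simp

theorem quad_one (z x : Euc d) : quad 1 (‖z‖ ^ 2) z x = ‖x - z‖ ^ 2 := by
  rw [quad, norm_sub_sq_real, real_inner_comm]; ring

/-- The regularised fundamental solution centred at `z`. -/
def pot (ε : ℝ) (z x : Euc d) : ℝ := radF d ε (‖x - z‖ ^ 2)

/-- A radial mollifier supported in `closedBall z ε`. -/
def mol (ε : ℝ) (z x : Euc d) : ℝ := 4 * radB d ε (‖x - z‖ ^ 2)

theorem pot_eq (ε : ℝ) (z : Euc d) : pot ε z = fun x => radF d ε (quad 1 (‖z‖ ^ 2) z x) := by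
  funext x; rw [quad_one]; rfl

theorem contDiff_pot {ε : ℝ} (hε : 0 < ε) (z : Euc d) : ContDiff ℝ ∞ (pot ε z) := by
  rw [pot_eq]
  exact (contDiff_radF d hε).comp (contDiff_quad _ _ _)

theorem lap_pot {ε : ℝ} (hε : 0 < ε) (z x : Euc d) : lap (pot ε z) x = -mol ε z x := by
  rw [pot_eq, lap_comp_quad (contDiff_radF d hε), one_smul, quad_one, mol, radB]
  ring

theorem mol_eq {ε : ℝ} (hε : 0 < ε) (z : Euc d) : mol ε z = (-1 : ℝ) • lap (pot ε z) := by
  funext x; simp [lap_pot hε]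

theorem mol_nonneg {ε : ℝ} (hε : 0 < ε) (z x : Euc d) : 0 ≤ mol ε z x :=
  mul_nonneg (by norm_num) (radB_nonneg d hε _)

theorem mol_eq_zero {ε : ℝ} (hε : 0 < ε) {z x : Euc d} (h : ε < ‖x - z‖) : mol ε z x = 0 := by
  rw [mol, radB_of_gt d hε (by gcongr), mul_zero]

theorem tsupport_mol {ε : ℝ} (hε : 0 < ε) (z : Euc d) : tsupport (mol ε z) ⊆ closedBall z ε :=
  closure_minimal (fun x hx => by
    by_contra h
    rw [mem_closedBall_iff_norm, not_le] at h
    exact hx (mol_eq_zero hε h)) isClosed_closedBall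

theorem isTestFun_mol {ε : ℝ} (hε : 0 < ε) (z : Euc d) : IsTestFun (mol ε z) := by
  refine ⟨?_, (isCompact_closedBall z ε).of_isClosed_subset (isClosed_tsupport _)
    (tsupport_mol hε z)⟩
  rw [mol_eq hε]
  exact (contDiff_pot hε z).lap.const_smul (-1 : ℝ)

theorem radF_sub_radF {ε ε' s t : ℝ} (hε : 0 < ε) (hε' : 0 < ε') (hs : ε ^ 2 ≤ s) (hs' : ε' ^ 2 ≤ s)
    (ht : ε ^ 2 ≤ t) (ht' : ε' ^ 2 ≤ t) :
    radF d ε s - radF d ε t = radF d ε' s - radF d ε' t := by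
  rw [radF_sub d hε, radF_sub d hε']
  refine intervalIntegral.integral_congr fun x hx => ?_
  have h1 : ε ^ 2 ≤ x := (le_min hs ht).trans hx.1
  have h2 : ε' ^ 2 ≤ x := (le_min hs' ht').trans hx.1
  simp only [radE, radCut_of_ge hε h1, radCut_of_ge hε' h2]

theorem exists_lap_eq_mol_sub {ε ε' a : ℝ} (hε : 0 < ε) (hε' : 0 < ε') (ha : ε < a) (ha' : ε' < a)
    (z : Euc d) : ∃ g : Euc d → ℝ, IsTestFun g ∧ tsupport g ⊆ ball z a ∧
      lap g = mol ε z - mol ε' z := by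
  set T := max ε ε' with hT
  have hT0 : 0 < T := lt_max_of_lt_left hε
  have h1 : ε ^ 2 ≤ T ^ 2 := by gcongr; exact le_max_left _ _
  have h2 : ε' ^ 2 ≤ T ^ 2 := by gcongr; exact le_max_right _ _
  set k : ℝ := radF d ε' (T ^ 2) - radF d ε (T ^ 2) with hk
  set g : Euc d → ℝ := pot ε' z - (pot ε z + fun _ => k) with hg
  have hgz : ∀ x, T < ‖x - z‖ → g x = 0 := fun x hx => by
    have h3 : T ^ 2 ≤ ‖x - z‖ ^ 2 := by gcongr
    have := radF_sub_radF (d := d) hε hε' (h1.trans h3) (h2.trans h3) h1 h2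
    simp only [hg, Pi.sub_apply, Pi.add_apply, pot, hk]
    linarith
  have hts : tsupport g ⊆ closedBall z T := closure_minimal (fun x hx => by
    by_contra h
    rw [mem_closedBall_iff_norm, not_le] at h
    exact hx (hgz x h)) isClosed_closedBall
  have hc : ContDiff ℝ ∞ (pot ε z + fun _ : Euc d => k) := (contDiff_pot hε z).add contDiff_const
  refine ⟨g, ⟨(contDiff_pot hε' z).sub hc, (isCompact_closedBall z T).of_isClosed_subset
    (isClosed_tsupport _) hts⟩, hts.trans (closedBall_subset_ball (max_lt ha ha')), ?_⟩
  rw [hg, lap_sub (contDiff_pot hε' z) hc, lap_add (contDiff_pot hε z) contDiff_const, lap_const]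
  funext x
  simp only [Pi.sub_apply, Pi.add_apply, lap_pot hε, lap_pot hε', Pi.zero_apply]
  ring

/-- The total mass of the mollifiers `mol ε z`. -/
def molMass (d : ℕ) : ℝ := ∫ x, mol 1 (0 : Euc d) x

theorem IsTestFun.integrable {g : Euc d → ℝ} (hg : IsTestFun g) : Integrable g :=
  hg.1.continuous.integrable_of_hasCompactSupport hg.2

theorem integral_mol {ε : ℝ} (hε : 0 < ε) (z : Euc d) : ∫ x, mol ε z x = molMass d := by
  obtain ⟨g, hg, -, hlap⟩ := exists_lap_eq_mol_sub hε one_pos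
    (lt_of_le_of_lt (le_max_left ε 1) (lt_add_one _))
    (lt_of_le_of_lt (le_max_right ε 1) (lt_add_one _)) z
  have h := integral_lap hg
  rw [hlap, integral_sub' (isTestFun_mol hε z).integrable (isTestFun_mol one_pos z).integrable,
    sub_eq_zero] at h
  rw [h, molMass, ← integral_sub_right_eq_self (fun x => mol 1 (0 : Euc d) x) z]
  simp [mol]

theorem molMass_pos (hd : 2 ≤ d) : 0 < molMass d := by
  obtain ⟨t, ht, hb⟩ := exists_radB_ne_zero d one_pos
  have h := isTestFun_mol one_pos (0 : Euc d)
  refine h.1.continuous.integral_pos_of_hasCompactSupport_nonneg_nonzero h.2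
    (mol_nonneg one_pos 0) (x := EuclideanSpace.single (⟨0, by omega⟩ : Fin d) (√t)) ?_
  simp [mol, Real.sq_sqrt ht.le, hb]

theorem integrableOn_mul_isTestFun {u g : Euc d → ℝ} {D : Set (Euc d)} (hu : ContinuousOn u D)
    (hg : IsTestFun g) (hgD : tsupport g ⊆ D) : IntegrableOn (fun x => u x * g x) D := by
  have h1 : IntegrableOn (fun x => u x * g x) (tsupport g) :=
    ((hu.mono hgD).mul hg.1.continuous.continuousOn).integrableOn_compact hg.2.isCompact
  refine IntegrableOn.mono_set ((integrableOn_iff_integrable_of_support_subset ?_).mp h1).integrableOn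
    (subset_univ D)
  intro x hx
  refine subset_tsupport g fun h => hx ?_
  simp [h]

/-- The mean value property, against the radial mollifiers. -/
theorem IsHarmonicOn.integral_mul_mol {u : Euc d → ℝ} {z : Euc d} {a ε : ℝ}
    (hu : IsHarmonicOn u (ball z a)) (hε : 0 < ε) (hεa : ε < a) :
    ∫ x in ball z a, u x * mol ε z x = molMass d * u z := by
  have hcont : ContinuousOn u (ball z a) := hu.1.continuousOn
  have hsub : ∀ {δ : ℝ}, 0 < δ → δ < a → tsupport (mol δ z) ⊆ ball z a := fun h h' =>
    (tsupport_mol h z).trans (closedBall_subset_ball h')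
  have hM : 0 ≤ molMass d := integral_nonneg (mol_nonneg one_pos 0)
  have hind : ∀ δ, 0 < δ → δ < a →
      ∫ x in ball z a, u x * mol ε z x = ∫ x in ball z a, u x * mol δ z x := fun δ hδ hδa => by
    obtain ⟨g, hg, hgs, hlap⟩ := exists_lap_eq_mol_sub hε hδ hεa hδa z
    have h := hu.integral_mul_lap isOpen_ball hg hgs
    simp only [hlap, Pi.sub_apply, mul_sub] at h
    rwa [integral_sub (integrableOn_mul_isTestFun hcont (isTestFun_mol hε z) (hsub hε hεa))
      (integrableOn_mul_isTestFun hcont (isTestFun_mol hδ z) (hsub hδ hδa)), sub_eq_zero] at h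
  have key : ∀ η > 0, |(∫ x in ball z a, u x * mol ε z x) - molMass d * u z| ≤ η * molMass d := by
    intro η hη
    have ha : 0 < a := hε.trans hεa
    have hc := (hcont.continuousAt (ball_mem_nhds z ha))
    obtain ⟨δ₀, hδ₀, hδ⟩ := Metric.continuousAt_iff.mp hc η hη
    obtain ⟨δ, h0, hlt⟩ := exists_between (lt_min hδ₀ ha)
    have hδ1 : δ < δ₀ := hlt.trans_le (min_le_left _ _)
    have hδa : δ < a := hlt.trans_le (min_le_right _ _)
    have hmol := isTestFun_mol h0 z
    have h1 : ∫ x in ball z a, mol δ z x = molMass d := by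
      rw [setIntegral_eq_integral_of_forall_compl_eq_zero, integral_mol h0]
      intro x hx
      exact image_eq_zero_of_notMem_tsupport fun h => hx (hsub h0 hδa h)
    rw [hind δ h0 hδa, ← h1, ← integral_mul_const, ← integral_sub
      (integrableOn_mul_isTestFun hcont hmol (hsub h0 hδa))
      ((hmol.integrable.integrableOn).mul_const _), ← integral_const_mul, ← Real.norm_eq_abs]
    refine norm_integral_le_of_norm_le ((hmol.integrable.integrableOn).const_mul _)
      (Eventually.of_forall fun x => ?_)
    rw [mul_comm (mol δ z x), ← sub_mul, norm_mul, Real.norm_of_nonneg (mol_nonneg h0 z x)]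
    by_cases hx : δ < ‖x - z‖
    · rw [mol_eq_zero h0 hx]; simp
    · refine mul_le_mul_of_nonneg_right ?_ (mol_nonneg h0 z x)
      have := hδ (x := x) (by rw [dist_eq_norm]; exact (not_lt.mp hx).trans_lt hδ1)
      rw [dist_eq_norm] at this
      exact this.le
  have h0 : |(∫ x in ball z a, u x * mol ε z x) - molMass d * u z| ≤ 0 := by
    refine le_of_forall_pos_le_add fun η hη => ?_
    refine (key (η / (molMass d + 1)) (by positivity)).trans ?_
    rw [zero_add, div_mul_eq_mul_div, div_le_iff₀ (by positivity)]
    nlinarith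
  exact sub_eq_zero.mp (abs_nonpos_iff.mp h0)

/-- The profile `radF` is an affine function of `sFun` away from the origin. -/
theorem exists_radF_sub_eq (hd : 2 ≤ d) : ∃ κ : ℝ, 0 < κ ∧ ∀ ε A B : ℝ, 0 < ε → ε ≤ A → ε ≤ B →
    radF d ε (A ^ 2) - radF d ε (B ^ 2) = κ * (sFun d A - sFun d B) := by
  have hpow : ∀ ε A B : ℝ, 0 < ε → ε ≤ A → ε ≤ B →
      radF d ε (A ^ 2) - radF d ε (B ^ 2) = ∫ s in A ^ 2..B ^ 2, s ^ (-(d : ℝ) / 2) := by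
    intro ε A B hε hA hB
    rw [radF_sub d hε]
    refine intervalIntegral.integral_congr fun x hx => ?_
    have h1 : ε ^ 2 ≤ x := (le_min (by gcongr) (by gcongr)).trans hx.1
    simp only [radE, radCut_of_ge hε h1, one_mul]
  rcases hd.eq_or_lt with rfl | hd
  · refine ⟨2, two_pos, fun ε A B hε hA hB => ?_⟩
    have hA0 := hε.trans_le hA
    have hB0 := hε.trans_le hB
    rw [hpow ε A B hε hA hB]
    have : ∀ s : ℝ, s ^ (-((2 : ℕ) : ℝ) / 2) = s⁻¹ := fun s => by
      rw [← Real.rpow_neg_one]; norm_num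
    simp only [this, sFun, if_true]
    rw [integral_inv_of_pos (by positivity) (by positivity), Real.log_div (by positivity)
      (by positivity), Real.log_pow, Real.log_pow]
    push_cast; ring
  · have hd' : (2 : ℝ) < d := by exact_mod_cast hd
    have hd2 : (0 : ℝ) < d - 2 := by linarith
    refine ⟨2 / (d - 2), by positivity, fun ε A B hε hA hB => ?_⟩
    have hA0 := hε.trans_le hA
    have hB0 := hε.trans_le hB
    rw [hpow ε A B hε hA hB, integral_rpow (Or.inr ⟨by linarith, ?_⟩)]
    · have hs : ∀ t : ℝ, 0 < t → (t ^ 2) ^ (-(d : ℝ) / 2 + 1) = sFun d t := fun t ht => by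
        rw [sFun, if_neg (by omega), ← Real.rpow_natCast, ← Real.rpow_mul ht.le]
        congr 1; push_cast; ring
      rw [hs A hA0, hs B hB0]
      have : -(d : ℝ) / 2 + 1 = -((d - 2) / 2) := by ring
      rw [this]
      field_simp
      ring
    · exact notMem_uIcc_of_lt (by positivity) (by positivity)

/-- A smooth function which agrees with a multiple of the Green function of the unit ball away
from its pole `y`. -/
def greenPot (ε : ℝ) (y x : Euc d) : ℝ := pot ε y x - radF d ε (quad (‖y‖ ^ 2) 1 y x)

theorem contDiff_greenPot {ε : ℝ} (hε : 0 < ε) (y : Euc d) : ContDiff ℝ ∞ (greenPot ε y) :=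
  (contDiff_pot hε y).sub ((contDiff_radF d hε).comp (contDiff_quad _ _ _))

theorem quad_sub_norm_sq (x y : Euc d) :
    quad (‖y‖ ^ 2) 1 y x = ‖x - y‖ ^ 2 + (1 - ‖x‖ ^ 2) * (1 - ‖y‖ ^ 2) := by
  rw [quad, norm_sub_sq_real, real_inner_comm]; ring

theorem one_sub_norm_sq_le_quad {x y : Euc d} (hx : ‖x‖ ≤ 1) (hy : ‖y‖ < 1) :
    (1 - ‖y‖) ^ 2 ≤ quad (‖y‖ ^ 2) 1 y x := by
  have h1 := abs_norm_sub_norm_le x y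
  have h2 : (‖x‖ - ‖y‖) ^ 2 ≤ ‖x - y‖ ^ 2 := by
    rw [← sq_abs]; gcongr
  rw [quad_sub_norm_sq]
  nlinarith [mul_nonneg (norm_nonneg y) (sub_nonneg.mpr hx), norm_nonneg x,
    mul_nonneg (mul_nonneg (norm_nonneg y) (sub_nonneg.mpr hx)) (sub_nonneg.mpr hx),
    mul_nonneg (norm_nonneg y) (sq_nonneg (1 - ‖x‖)), mul_nonneg (norm_nonneg x) (norm_nonneg y)]

theorem norm_smul_sub_sq (x y : Euc d) :
    ‖‖y‖ ^ 2 • x - y‖ ^ 2 = ‖y‖ ^ 2 * quad (‖y‖ ^ 2) 1 y x := by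
  rw [norm_sub_sq_real, norm_smul, real_inner_smul_left, quad, real_inner_comm]
  simp
  ring

theorem lap_greenPot {ε : ℝ} (hε : 0 < ε) {x y : Euc d} (hy : ε < 1 - ‖y‖) (hx : ‖x‖ ≤ 1) :
    lap (greenPot ε y) x = -mol ε y x := by
  have hF := contDiff_radF d hε
  have hq : ε ^ 2 < quad (‖y‖ ^ 2) 1 y x :=
    (by gcongr : ε ^ 2 < (1 - ‖y‖) ^ 2).trans_le (one_sub_norm_sq_le_quad hx (by linarith))
  have h0 := radB_of_gt d hε hq
  have : greenPot ε y = pot ε y - fun x => radF d ε (quad (‖y‖ ^ 2) 1 y x) := rfl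
  rw [this, lap_sub (v := fun x => radF d ε (quad (‖y‖ ^ 2) 1 y x)) (contDiff_pot hε y)
    (hF.comp (contDiff_quad _ _ _)), Pi.sub_apply,
    lap_pot hε, lap_comp_quad hF, norm_smul_sub_sq]
  rw [radB] at h0
  linear_combination (4 * ‖y‖ ^ 2) * h0

theorem greenPot_eq_integral {ε : ℝ} (hε : 0 < ε) (x y : Euc d) :
    greenPot ε y x = ∫ s in ‖x - y‖ ^ 2..quad (‖y‖ ^ 2) 1 y x, radE d ε s := by
  rw [greenPot, pot, radF_sub d hε]

theorem greenPot_nonneg {ε : ℝ} (hε : 0 < ε) {x y : Euc d} (hx : ‖x‖ ≤ 1) (hy : ‖y‖ ≤ 1) :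
    0 ≤ greenPot ε y x := by
  rw [greenPot_eq_integral hε]
  have hle : ‖x - y‖ ^ 2 ≤ quad (‖y‖ ^ 2) 1 y x := by
    rw [quad_sub_norm_sq]
    nlinarith [mul_nonneg (sub_nonneg.mpr (pow_le_one₀ (n := 2) (norm_nonneg x) hx))
      (sub_nonneg.mpr (pow_le_one₀ (n := 2) (norm_nonneg y) hy))]
  refine intervalIntegral.integral_nonneg hle fun s hs => mul_nonneg ?_ ?_
  · exact Real.smoothTransition.nonneg _
  · exact Real.rpow_nonneg ((sq_nonneg _).trans hs.1) _

theorem exists_abs_greenPot_le {ε : ℝ} (hε : 0 < ε) {y : Euc d} (hy : ‖y‖ ≤ 1) :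
    ∃ C : ℝ, 0 ≤ C ∧ ∀ x : Euc d, ‖x‖ ≤ 1 → |greenPot ε y x| ≤ C * (1 - ‖x‖ ^ 2) := by
  obtain ⟨C, hC⟩ := (isCompact_Icc (a := (0 : ℝ)) (b := 5)).exists_bound_of_continuousOn
    (contDiff_radE d hε).continuous.continuousOn
  have hC0 : 0 ≤ C := (norm_nonneg _).trans (hC 0 (by norm_num))
  refine ⟨C, hC0, fun x hx => ?_⟩
  have hx2 : ‖x‖ ^ 2 ≤ 1 := pow_le_one₀ (norm_nonneg x) hx
  have hy2 : ‖y‖ ^ 2 ≤ 1 := pow_le_one₀ (norm_nonneg y) hy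
  have hA : ‖x - y‖ ^ 2 ≤ 4 := by
    have h1 : ‖x - y‖ ≤ 2 := (norm_sub_le x y).trans (by linarith)
    nlinarith [norm_nonneg (x - y)]
  have hq := quad_sub_norm_sq x y
  have hp : (1 - ‖x‖ ^ 2) * (1 - ‖y‖ ^ 2) ≤ 1 - ‖x‖ ^ 2 := by
    nlinarith [sq_nonneg ‖y‖]
  have hp0 : 0 ≤ (1 - ‖x‖ ^ 2) * (1 - ‖y‖ ^ 2) := mul_nonneg (by linarith) (by linarith)
  rw [greenPot_eq_integral hε, ← Real.norm_eq_abs]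
  refine (intervalIntegral.norm_integral_le_of_norm_le_const fun s hs => hC s ?_).trans ?_
  · rw [uIoc_of_le (by linarith)] at hs
    exact ⟨(sq_nonneg _).trans hs.1.le, hs.2.trans (by nlinarith [sq_nonneg ‖x‖])⟩
  · rw [abs_of_nonneg (by linarith)]
    exact mul_le_mul_of_nonneg_left (by linarith) hC0

theorem exists_greenPot_eq (hd : 2 ≤ d) : ∃ κ : ℝ, 0 < κ ∧ ∀ (ε : ℝ) (x y : Euc d), 0 < ε →
    ε < 1 - ‖y‖ → ε ≤ ‖x - y‖ → ‖x‖ < 1 → greenPot ε y x = κ * greenBall d y x := by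
  obtain ⟨κ, hκ, h⟩ := exists_radF_sub_eq hd
  refine ⟨κ, hκ, fun ε x y hε hy hxy hx => ?_⟩
  rw [greenPot, pot, greenBall]
  split_ifs with h0
  · have hq : quad (‖y‖ ^ 2) 1 y x = 1 ^ 2 := by simp [h0, quad]
    rw [hq, h ε _ _ hε hxy (by linarith [norm_nonneg y])]
    simp [h0]
  · have hy0 : 0 < ‖y‖ := norm_pos_iff.mpr h0
    have hq : quad (‖y‖ ^ 2) 1 y x = (‖y‖ * ‖x - (‖y‖ ^ 2)⁻¹ • y‖) ^ 2 := by
      have h2 : ‖y‖ ^ 2 • x - y = ‖y‖ ^ 2 • (x - (‖y‖ ^ 2)⁻¹ • y) := by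
        rw [smul_sub, smul_inv_smul₀ (by positivity)]
      have h3 := norm_smul_sub_sq x y
      rw [h2, norm_smul] at h3
      have h4 : ‖y‖ ^ 2 ≠ 0 := by positivity
      apply mul_left_cancel₀ h4
      rw [← h3]
      simp
      ring
    rw [hq, h ε _ _ hε hxy, norm_sub_rev x y]
    refine le_of_sq_le_sq ?_ (by positivity)
    rw [← hq]
    exact le_trans (by gcongr) (one_sub_norm_sq_le_quad hx.le (by linarith))

theorem IsTestFun.contDiff_mul {u g : Euc d → ℝ} (hg : IsTestFun g) (hu : ContDiff ℝ ∞ u) :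
    IsTestFun (u * g) :=
  ⟨hu.mul hg.1, hg.2.mul_left⟩

/-- An additive functional on test functions which vanishes locally in `U` vanishes on all test
functions supported in `U`. -/
theorem eq_zero_of_locally_eq_zero {U : Set (Euc d)} (T : (Euc d → ℝ) → ℝ)
    (hadd : ∀ f g, IsTestFun f → IsTestFun g → T (f + g) = T f + T g)
    (hloc : ∀ x ∈ U, ∃ r > 0, ∀ g, IsTestFun g → tsupport g ⊆ ball x r → T g = 0)
    {g : Euc d → ℝ} (hg : IsTestFun g) (hgU : tsupport g ⊆ U) : T g = 0 := by
  choose! r hr hT using hloc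
  have h0 : T 0 = 0 := by
    have hz : IsTestFun (0 : Euc d → ℝ) := ⟨contDiff_const, HasCompactSupport.zero⟩
    have := hadd 0 0 hz hz
    simpa using this
  have key : ∀ s : Finset (Euc d), ∀ g : Euc d → ℝ, (∀ x ∈ s, x ∈ U) → IsTestFun g →
      tsupport g ⊆ ⋃ x ∈ s, ball x (r x / 2) → T g = 0 := by
    intro s
    induction s using Finset.induction_on with
    | empty =>
      intro g _ _ hs
      have hg0 : g = 0 := tsupport_eq_empty_iff.mp (by simpa using hs)
      rw [hg0, h0]
    | insert a s _ ih =>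
      intro g hsU hg hs
      have ha := hr a (hsU a (Finset.mem_insert_self a s))
      let χ : ContDiffBump a := ⟨r a / 2, 3 / 4 * r a, by positivity, by linarith⟩
      have hχ : ContDiff ℝ ∞ (χ : Euc d → ℝ) := χ.contDiff
      have hχ' : ContDiff ℝ ∞ (fun x => 1 - χ x) := contDiff_const.sub hχ
      have h1 : IsTestFun ((χ : Euc d → ℝ) * g) := hg.contDiff_mul hχ
      have h2 : IsTestFun ((fun x => 1 - χ x) * g) := hg.contDiff_mul hχ'
      have hsplit : g = (χ : Euc d → ℝ) * g + (fun x => 1 - χ x) * g := by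
        funext x; simp; ring
      rw [hsplit, hadd _ _ h1 h2, hT a (hsU a (Finset.mem_insert_self a s)) _ h1 ?_,
        ih _ (fun x hx => hsU x (Finset.mem_insert_of_mem hx)) h2 ?_, add_zero]
      · intro x hx
        have hx1 : x ∈ tsupport g := tsupport_mul_subset_right hx
        have hx2 := hs hx1
        have hx3 : x ∉ ball a (r a / 2) := by
          intro hxa
          have : (fun x => 1 - χ x) * g =ᶠ[𝓝 x] 0 := by
            filter_upwards [isOpen_ball.mem_nhds hxa] with y hy
            simp [χ.one_of_mem_closedBall (ball_subset_closedBall hy)]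
          exact notMem_tsupport_iff_eventuallyEq.mpr this hx
        rw [Finset.set_biUnion_insert] at hx2
        exact hx2.resolve_left hx3
      · refine (tsupport_mul_subset_left).trans ?_
        rw [χ.tsupport_eq]
        exact closedBall_subset_ball (show 3 / 4 * r a < r a by linarith)
  obtain ⟨s, hsK, hs⟩ := hg.2.isCompact.elim_nhds_subcover (fun x => ball x (r x / 2))
    (fun x hx => ball_mem_nhds x (half_pos (hr x (hgU hx))))
  exact key s g (fun x hx => hgU (hsK x hx)) hg hs

section Joint

variable {E F : Type*} [NormedAddCommGroup E] [NormedSpace ℝ E] [NormedAddCommGroup F]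
  [NormedSpace ℝ F]

theorem iteratedFDeriv_slice {G : ℝ → E → F} (hG : ContDiff ℝ ∞ (fun p : ℝ × E => G p.1 p.2))
    (m : ℕ) (r : ℝ) (x : E) : iteratedFDeriv ℝ m (G r) x =
      (iteratedFDeriv ℝ m (fun p : ℝ × E => G p.1 p.2) (r, x)).compContinuousLinearMap
        fun _ => ContinuousLinearMap.inr ℝ ℝ E := by
  have h1 : G r = (fun q : ℝ × E => (fun p : ℝ × E => G p.1 p.2) ((r, 0) + q)) ∘
      ContinuousLinearMap.inr ℝ ℝ E := by
    funext y; simp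
  have h2 : ContDiff ℝ ∞ (fun q : ℝ × E => (fun p : ℝ × E => G p.1 p.2) ((r, 0) + q)) :=
    hG.comp (contDiff_const.add contDiff_id)
  rw [h1, ContinuousLinearMap.iteratedFDeriv_comp_right _ h2 x (i := m) (by norm_cast; exact le_top),
    iteratedFDeriv_comp_add_left (f := fun p : ℝ × E => G p.1 p.2) m (r, 0)]
  simp

theorem continuous_iteratedFDeriv_slice {G : ℝ → E → F}
    (hG : ContDiff ℝ ∞ (fun p : ℝ × E => G p.1 p.2)) (m : ℕ) :
    Continuous (fun p : ℝ × E => iteratedFDeriv ℝ m (G p.1) p.2) := by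
  simp only [iteratedFDeriv_slice hG]
  exact (ContinuousMultilinearMap.compContinuousLinearMapL (𝕜 := ℝ) (F := F)
    fun _ : Fin m => ContinuousLinearMap.inr ℝ ℝ E).continuous.comp
      (hG.continuous_iteratedFDeriv (by norm_cast; exact le_top))

theorem tendstoUniformly_iteratedFDeriv {G : ℝ → E → F}
    (hG : ContDiff ℝ ∞ (fun p : ℝ × E => G p.1 p.2)) {K : Set E} (hK : IsCompact K)
    (hsupp : ∀ r, tsupport (G r) ⊆ K) {r : ℕ → ℝ} (hr : Tendsto r atTop (𝓝 0)) (m : ℕ) :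
    TendstoUniformly (fun n => iteratedFDeriv ℝ m (G (r n))) (iteratedFDeriv ℝ m (G 0)) atTop := by
  have hc := continuous_iteratedFDeriv_slice hG m
  have hu := ((isCompact_closedBall (0 : ℝ) 1).prod hK).uniformContinuousOn_of_continuous
    hc.continuousOn
  rw [Metric.tendstoUniformly_iff]
  intro ε hε
  obtain ⟨δ, hδ, h⟩ := Metric.uniformContinuousOn_iff.mp hu ε hε
  filter_upwards [Metric.tendsto_nhds.mp hr δ hδ, Metric.tendsto_nhds.mp hr 1 one_pos] with n h1 h2 x
  by_cases hx : x ∈ K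
  · refine h (0, x) ⟨by simp, hx⟩ (r n, x) ⟨h2.le, hx⟩ ?_
    rw [Prod.dist_eq, dist_self, dist_comm]
    exact max_lt h1 hδ
  · have hz : ∀ s, iteratedFDeriv ℝ m (G s) x = 0 := fun s => by
      have := (notMem_tsupport_iff_eventuallyEq.mp fun hh => hx (hsupp s hh)).iteratedFDeriv ℝ m
      rw [this.eq_of_nhds]
      simp
    simp [hz, hε]

end Joint

theorem contDiff_lap_joint {G : ℝ → Euc d → ℝ}
    (hG : ContDiff ℝ ∞ (fun p : ℝ × Euc d => G p.1 p.2)) :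
    ContDiff ℝ ∞ (fun p : ℝ × Euc d => lap (G p.1) p.2) := by
  unfold lap
  refine ContDiff.sum fun i _ => ?_
  simp only [iteratedFDeriv_slice hG]
  exact ((ContinuousMultilinearMap.apply ℝ (fun _ : Fin 2 => ℝ × Euc d) ℝ
    (fun j => ContinuousLinearMap.inr ℝ ℝ (Euc d)
      (![EuclideanSpace.single i 1, EuclideanSpace.single i 1] j))).contDiff).comp
      (hG.iteratedFDeriv_right (m := ∞) (i := 2) (by norm_cast))

theorem quad_shell (t : ℝ) (x : Euc d) : quad (-t) t 0 x = t * (1 - ‖x‖ ^ 2) := by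
  simp [quad]; ring

/-- A cutoff vanishing near the boundary of the unit ball. -/
def bcut (t : ℝ) (x : Euc d) : ℝ := Real.smoothTransition (t * (1 - ‖x‖ ^ 2) - 1)

theorem contDiff_smoothTransition_sub_one :
    ContDiff ℝ ∞ fun s : ℝ => Real.smoothTransition (s - 1) :=
  Real.smoothTransition.contDiff.comp (contDiff_id.sub contDiff_const)

theorem bcut_eq (t : ℝ) :
    (bcut t : Euc d → ℝ) = fun x => (fun s => Real.smoothTransition (s - 1)) (quad (-t) t 0 x) := by
  funext x; simp only [quad_shell, bcut]

theorem contDiff_bcut (t : ℝ) : ContDiff ℝ ∞ (bcut t : Euc d → ℝ) := by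
  rw [bcut_eq]
  exact contDiff_smoothTransition_sub_one.comp (contDiff_quad _ _ _)

theorem bcut_of_le {t : ℝ} {x : Euc d} (h : t * (1 - ‖x‖ ^ 2) ≤ 1) : bcut t x = 0 :=
  Real.smoothTransition.zero_of_nonpos (by linarith)

theorem bcut_of_ge {t : ℝ} {x : Euc d} (h : 2 ≤ t * (1 - ‖x‖ ^ 2)) : bcut t x = 1 :=
  Real.smoothTransition.one_of_one_le (by linarith)

theorem continuous_shell (t : ℝ) : Continuous fun x : Euc d => t * (1 - ‖x‖ ^ 2) := by fun_prop

theorem tsupport_bcut (t : ℝ) : tsupport (bcut t : Euc d → ℝ) ⊆ {x | 1 ≤ t * (1 - ‖x‖ ^ 2)} :=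
  closure_minimal (fun x hx => by
    by_contra h
    exact hx (bcut_of_le (le_of_lt (not_le.mp h)))) (isClosed_le continuous_const (continuous_shell t))

theorem norm_lt_one_of_shell {t : ℝ} (ht : 0 < t) {x : Euc d} (h : 0 < t * (1 - ‖x‖ ^ 2)) :
    ‖x‖ < 1 := by
  by_contra hx
  have : 1 ≤ ‖x‖ ^ 2 := one_le_pow₀ (not_lt.mp hx)
  nlinarith

theorem tsupport_bcut_subset_ball {t : ℝ} (ht : 0 < t) :
    tsupport (bcut t : Euc d → ℝ) ⊆ ball 0 1 := fun x hx => by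
  rw [mem_ball_zero_iff]
  exact norm_lt_one_of_shell ht (lt_of_lt_of_le one_pos (tsupport_bcut t hx))

theorem isTestFun_bcut {t : ℝ} (ht : 0 < t) : IsTestFun (bcut t : Euc d → ℝ) :=
  ⟨contDiff_bcut t, (isCompact_closedBall (0 : Euc d) 1).of_isClosed_subset (isClosed_tsupport _)
    ((tsupport_bcut_subset_ball ht).trans ball_subset_closedBall)⟩

theorem exists_bcut_bounds : ∃ K : ℝ, 0 ≤ K ∧ ∀ (t : ℝ) (x : Euc d), 0 < t → ‖x‖ ≤ 1 →
    1 ≤ t * (1 - ‖x‖ ^ 2) → t * (1 - ‖x‖ ^ 2) ≤ 2 →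
      (∀ i, |pd i (bcut t) x| ≤ 2 * K * t) ∧ |lap (bcut t) x| ≤ K * (4 * t ^ 2 + 2 * d * t) := by
  set S : ℝ → ℝ := fun s => Real.smoothTransition (s - 1)
  have hS : ContDiff ℝ ∞ S := contDiff_smoothTransition_sub_one
  have hS1 : ContDiff ℝ ∞ (deriv S) := (contDiff_infty_iff_deriv.mp hS).2
  have hS2 : ContDiff ℝ ∞ (deriv (deriv S)) := (contDiff_infty_iff_deriv.mp hS1).2
  obtain ⟨K1, h1⟩ := (isCompact_Icc (a := (1 : ℝ)) (b := 2)).exists_bound_of_continuousOn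
    hS1.continuous.continuousOn
  obtain ⟨K2, h2⟩ := (isCompact_Icc (a := (1 : ℝ)) (b := 2)).exists_bound_of_continuousOn
    hS2.continuous.continuousOn
  have hK1 : 0 ≤ K1 := (norm_nonneg _).trans (h1 1 (by norm_num))
  refine ⟨max K1 K2, le_max_of_le_left hK1, fun t x ht hx hl hu => ?_⟩
  have hq : quad (-t) t 0 x ∈ Icc (1 : ℝ) 2 := by rw [quad_shell]; exact ⟨hl, hu⟩
  have b1 : |deriv S (quad (-t) t 0 x)| ≤ max K1 K2 := (h1 _ hq).trans (le_max_left _ _)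
  have b2 : |deriv (deriv S) (quad (-t) t 0 x)| ≤ max K1 K2 := (h2 _ hq).trans (le_max_right _ _)
  have hK : 0 ≤ max K1 K2 := le_max_of_le_left hK1
  rw [bcut_eq]
  constructor
  · intro i
    rw [pd_comp_quad hS, abs_mul]
    have hxi : |x i| ≤ 1 := (PiLp.norm_apply_le x i).trans hx
    have : |2 * (-t * x i - (0 : Euc d) i)| ≤ 2 * t := by
      simp [abs_mul, abs_of_pos ht]
      nlinarith
    calc _ ≤ max K1 K2 * (2 * t) := by gcongr
      _ = _ := by ring
  · rw [lap_comp_quad hS]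
    have hn : ‖(-t) • x - 0‖ ^ 2 ≤ t ^ 2 := by
      rw [sub_zero, norm_smul, Real.norm_eq_abs, abs_neg, abs_of_pos ht]
      gcongr
      nlinarith
    refine (abs_add_le _ _).trans ?_
    have a1 : |4 * ‖(-t) • x - 0‖ ^ 2 * deriv (deriv S) (quad (-t) t 0 x)| =
        4 * ‖(-t) • x - 0‖ ^ 2 * |deriv (deriv S) (quad (-t) t 0 x)| := by
      rw [abs_mul, abs_of_nonneg (by positivity)]
    have a2 : |2 * (d : ℝ) * -t * deriv S (quad (-t) t 0 x)| =
        2 * d * t * |deriv S (quad (-t) t 0 x)| := by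
      rw [abs_mul, show 2 * (d : ℝ) * -t = -(2 * d * t) by ring, abs_neg,
        abs_of_nonneg (by positivity)]
    have e1 : 4 * ‖(-t) • x - 0‖ ^ 2 * |deriv (deriv S) (quad (-t) t 0 x)| ≤
        4 * t ^ 2 * max K1 K2 := by gcongr
    have e2 : 2 * (d : ℝ) * t * |deriv S (quad (-t) t 0 x)| ≤ 2 * d * t * max K1 K2 := by gcongr
    linarith

/-- The error made by cutting off the Green potential near the boundary. -/
def bdryErr (ε : ℝ) (y : Euc d) (t : ℝ) : Euc d → ℝ :=
  lap (greenPot ε y * bcut t) + mol ε y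

theorem isTestFun_greenPot_mul_bcut {ε : ℝ} (hε : 0 < ε) (y : Euc d) {t : ℝ} (ht : 0 < t) :
    IsTestFun (greenPot ε y * bcut t) :=
  (isTestFun_bcut ht).contDiff_mul (contDiff_greenPot hε y)

theorem isTestFun_bdryErr {ε : ℝ} (hε : 0 < ε) (y : Euc d) {t : ℝ} (ht : 0 < t) :
    IsTestFun (bdryErr ε y t) :=
  (isTestFun_greenPot_mul_bcut hε y ht).lap.add (isTestFun_mol hε y)

theorem exists_bdryErr_bounds {ε : ℝ} (hε : 0 < ε) {y : Euc d} (hy : ε < 1 - ‖y‖) :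
    ∃ C T : ℝ, 1 ≤ C ∧ 3 ≤ T ∧ ∀ t, T ≤ t → (∀ x, |bdryErr ε y t x| ≤ C * t) ∧
      (∀ x, bdryErr ε y t x ≠ 0 → 1 ≤ t * (1 - ‖x‖ ^ 2) ∧ t * (1 - ‖x‖ ^ 2) ≤ 2) ∧
      (∀ x, ‖x - y‖ ≤ ε → 2 < t * (1 - ‖x‖ ^ 2)) := by
  obtain ⟨K, hK, hb⟩ := exists_bcut_bounds (d := d)
  obtain ⟨C0, hC0, hw⟩ := exists_abs_greenPot_le hε (y := y) (by linarith)
  have hwc := contDiff_greenPot hε y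
  have hpd : ∀ i, ∃ L, ∀ x ∈ closedBall (0 : Euc d) 1, ‖pd i (greenPot ε y) x‖ ≤ L := fun i =>
    (isCompact_closedBall (0 : Euc d) 1).exists_bound_of_continuousOn
      (hwc.pd i).continuous.continuousOn
  choose L hL using hpd
  have hL0 : ∀ i, 0 ≤ L i := fun i => (norm_nonneg _).trans (hL i 0 (by simp))
  set ρ := ‖y‖ + ε with hρ
  have hρ0 : 0 < ρ := by positivity
  have hρ1 : 0 < 1 - ρ ^ 2 := by nlinarith
  set C1 := 2 * C0 * K * (4 + 2 * d) + 4 * K * ∑ i, L i with hC1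
  have hsL : 0 ≤ ∑ i, L i := Finset.sum_nonneg fun i _ => hL0 i
  have hC10 : 0 ≤ C1 := by positivity
  refine ⟨1 + C1, max 3 (3 / (1 - ρ ^ 2)), by linarith, le_max_left _ _, fun t ht => ?_⟩
  have ht3 : 3 ≤ t := (le_max_left _ _).trans ht
  have ht0 : 0 < t := by linarith
  have htρ : 3 ≤ t * (1 - ρ ^ 2) := (div_le_iff₀ hρ1).mp ((le_max_right _ _).trans ht)
  have hmolx : ∀ x, ‖x - y‖ ≤ ε → 2 < t * (1 - ‖x‖ ^ 2) := fun x hx => by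
    have : ‖x‖ ≤ ρ := by
      have := norm_add_le (x - y) y
      rw [sub_add_cancel] at this
      linarith
    have h2 : ‖x‖ ^ 2 ≤ ρ ^ 2 := by gcongr
    nlinarith
  have hlow : ∀ x, t * (1 - ‖x‖ ^ 2) < 1 → bdryErr ε y t x = 0 := fun x hx => by
    have h1 : greenPot ε y * bcut t =ᶠ[𝓝 x] fun _ => 0 := by
      filter_upwards [(isOpen_lt (continuous_shell t) continuous_const).mem_nhds hx] with z hz
      simp [bcut_of_le (le_of_lt hz)]
    have h2 : mol ε y x = 0 := mol_eq_zero hε (by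
      by_contra h; linarith [hmolx x (not_lt.mp h)])
    rw [bdryErr, Pi.add_apply, lap_congr_nhds h1, lap_const, h2]
    simp
  have hhigh : ∀ x, 2 < t * (1 - ‖x‖ ^ 2) → bdryErr ε y t x = 0 := fun x hx => by
    have h1 : greenPot ε y * bcut t =ᶠ[𝓝 x] greenPot ε y := by
      filter_upwards [(isOpen_lt continuous_const (continuous_shell t)).mem_nhds hx] with z hz
      simp [bcut_of_ge (le_of_lt hz)]
    have hx1 : ‖x‖ < 1 := norm_lt_one_of_shell ht0 (by linarith)
    rw [bdryErr, Pi.add_apply, lap_congr_nhds h1, lap_greenPot hε hy hx1.le, neg_add_cancel]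
  refine ⟨fun x => ?_, fun x hx => ⟨?_, ?_⟩, hmolx⟩
  · have hCt : 0 ≤ (1 + C1) * t := by positivity
    rcases lt_or_ge (t * (1 - ‖x‖ ^ 2)) 1 with h | h1
    · rw [hlow x h, abs_zero]; exact hCt
    rcases lt_or_ge 2 (t * (1 - ‖x‖ ^ 2)) with h | h2
    · rw [hhigh x h, abs_zero]; exact hCt
    have hx1 : ‖x‖ < 1 := norm_lt_one_of_shell ht0 (by linarith)
    have hmol : mol ε y x = 0 := mol_eq_zero hε (by
      by_contra h; linarith [hmolx x (not_lt.mp h)])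
    obtain ⟨hb1, hb2⟩ := hb t x ht0 hx1.le h1 h2
    rw [bdryErr, Pi.add_apply, lap_mul hwc (contDiff_bcut t), lap_greenPot hε hy hx1.le, hmol]
    simp only [neg_zero, mul_zero, add_zero]
    have hwx : |greenPot ε y x| ≤ C0 * (2 / t) := (hw x hx1.le).trans (by
      gcongr
      rw [le_div_iff₀ ht0]; linarith)
    have e1 : |greenPot ε y x * lap (bcut t) x| ≤ C0 * (2 / t) * (K * (4 * t ^ 2 + 2 * d * t)) := by
      rw [abs_mul]; gcongr
    have e1' : C0 * (2 / t) * (K * (4 * t ^ 2 + 2 * d * t)) = 2 * C0 * K * (4 * t + 2 * d) := by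
      field_simp
    have e1'' : 2 * C0 * K * (4 * t + 2 * d) ≤ 2 * C0 * K * (4 + 2 * d) * t := by
      have : (d : ℝ) ≤ d * t := le_mul_of_one_le_right (by positivity) (by linarith)
      have h' : 4 * t + 2 * (d : ℝ) ≤ (4 + 2 * d) * t := by linarith
      calc _ ≤ 2 * C0 * K * ((4 + 2 * d) * t) := by gcongr
        _ = _ := by ring
    have e2 : |2 * ∑ i, pd i (greenPot ε y) x * pd i (bcut t) x| ≤ 4 * K * (∑ i, L i) * t := by
      rw [abs_mul, abs_two]
      have : |∑ i, pd i (greenPot ε y) x * pd i (bcut t) x| ≤ ∑ i, L i * (2 * K * t) := by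
        refine (Finset.abs_sum_le_sum_abs _ _).trans (Finset.sum_le_sum fun i _ => ?_)
        rw [abs_mul]
        exact mul_le_mul (hL i x (by simpa using hx1.le)) (hb1 i) (abs_nonneg _) (hL0 i)
      rw [← Finset.sum_mul] at this
      linarith
    refine (abs_add_le _ _).trans ?_
    rw [hC1]
    linarith
  · by_contra h
    exact hx (hlow x (not_le.mp h))
  · by_contra h
    exact hx (hhigh x (not_le.mp h))

/-- A fixed bump equal to one on `[1, 2]`. -/
def shellBump : ContDiffBump (3 / 2 : ℝ) := ⟨1 / 2, 1, by norm_num, by norm_num⟩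

/-- A radial bump on a thin shell near the boundary of the unit ball. -/
def sbump (t : ℝ) (x : Euc d) : ℝ := shellBump (t * (1 - ‖x‖ ^ 2))

theorem sbump_eq_zero {t : ℝ} {x : Euc d}
    (h : ¬(1 / 2 ≤ t * (1 - ‖x‖ ^ 2) ∧ t * (1 - ‖x‖ ^ 2) ≤ 5 / 2)) : sbump t x = 0 := by
  refine shellBump.zero_of_le_dist ?_
  rw [Real.dist_eq, le_abs]
  simp only [shellBump]
  by_contra! hc
  exact h ⟨by linarith [hc.2], by linarith [hc.1]⟩

theorem sbump_eq_one {t : ℝ} {x : Euc d} (h1 : 1 ≤ t * (1 - ‖x‖ ^ 2)) (h2 : t * (1 - ‖x‖ ^ 2) ≤ 2) :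
    sbump t x = 1 := by
  refine shellBump.one_of_mem_closedBall ?_
  rw [mem_closedBall, Real.dist_eq, abs_le]
  simp only [shellBump]
  constructor <;> linarith

theorem isTestFun_sbump {t : ℝ} (ht : 0 < t) : IsTestFun (sbump t : Euc d → ℝ) := by
  constructor
  · have : (sbump t : Euc d → ℝ) = fun x => shellBump (quad (-t) t 0 x) := by
      funext x; simp only [quad_shell, sbump]
    rw [this]
    exact shellBump.contDiff.comp (contDiff_quad _ _ _)
  · refine HasCompactSupport.intro (isCompact_closedBall (0 : Euc d) 1) fun x hx => ?_
    refine sbump_eq_zero fun h => hx ?_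
    rw [mem_closedBall_zero_iff]
    exact (norm_lt_one_of_shell ht (by linarith)).le

/-- Boundary layers of bounded mass: a function which is bounded by `C t` and lives on a shell of
width `1/t` gives rise to data as in the zero boundary condition. -/
theorem shell_integral_le (hd : 2 ≤ d) {t C : ℝ} (ht : 3 ≤ t) (hC : 0 ≤ C) {f : Euc d → ℝ}
    (hf : IsTestFun f) (hb : ∀ x, f x ≤ 3 * C * t)
    (hz : ∀ x, f x ≠ 0 → 1 / 2 ≤ t * (1 - ‖x‖ ^ 2) ∧ t * (1 - ‖x‖ ^ 2) ≤ 5 / 2) :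
    ∫ x, f x ≤ 8 * C * d * volume.real (ball (0 : Euc d) 1) := by
  have ht0 : 0 < t := by linarith
  set s : ℝ := 5 / (2 * t) with hs
  have hs1 : s ≤ 1 := by rw [hs, div_le_one (by positivity)]; linarith
  have hs0 : 0 < s := by positivity
  set A : Set (Euc d) := ball 0 1 \ ball 0 (1 - s) with hA
  have hAm : MeasurableSet A := measurableSet_ball.diff measurableSet_ball
  have hsub : ∀ x, x ∉ A → f x = 0 := fun x hx => by
    by_contra hne
    obtain ⟨h1, h2⟩ := hz x hne
    have hx1 := norm_lt_one_of_shell ht0 (x := x) (by linarith)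
    refine hx ⟨by simpa using hx1, ?_⟩
    simp only [mem_ball_zero_iff, not_lt]
    have h3 : 1 - ‖x‖ ^ 2 ≤ s := by
      rw [hs, le_div_iff₀ (by positivity)]; linarith
    nlinarith [norm_nonneg x]
  have hvol : volume.real A ≤ d * s * volume.real (ball (0 : Euc d) 1) := by
    have : NeZero d := ⟨by omega⟩
    rw [hA, measureReal_sdiff (ball_subset_ball (by linarith)) measurableSet_ball (by
      exact measure_ball_lt_top.ne)]
    have h1 : volume.real (ball (0 : Euc d) (1 - s)) =
        (1 - s) ^ d * volume.real (ball (0 : Euc d) 1) := by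
      have : Nontrivial (Euc d) := inferInstance
      rw [measureReal_def, Measure.addHaar_ball volume _ (by linarith : 0 ≤ 1 - s),
        ENNReal.toReal_mul, ENNReal.toReal_ofReal (pow_nonneg (by linarith) _), measureReal_def]
      simp
    rw [h1]
    have hbern := one_add_mul_le_pow (a := -s) (by linarith) d
    have hv : 0 ≤ volume.real (ball (0 : Euc d) 1) := measureReal_nonneg
    rw [← sub_eq_add_neg] at hbern
    nlinarith
  have hv : 0 ≤ volume.real (ball (0 : Euc d) 1) := measureReal_nonneg
  have hAfin : volume A < ⊤ := (measure_mono Set.sdiff_subset).trans_lt measure_ball_lt_top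
  calc ∫ x, f x = ∫ x in A, f x := (setIntegral_eq_integral_of_forall_compl_eq_zero hsub).symm
    _ ≤ ∫ _ in A, 3 * C * t :=
      setIntegral_mono hf.integrable.integrableOn (integrableOn_const hAfin.ne) hb
    _ = 3 * C * t * volume.real A := by rw [setIntegral_const, smul_eq_mul, mul_comm]
    _ ≤ 3 * C * t * (d * s * volume.real (ball (0 : Euc d) 1)) := by gcongr
    _ = 15 / 2 * C * d * volume.real (ball (0 : Euc d) 1) := by rw [hs]; field_simp; ring
    _ ≤ _ := by
      have : 0 ≤ C * d * volume.real (ball (0 : Euc d) 1) := by positivity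
      linarith

end

section

variable {d : ℕ} {Ω : Type} [MeasurableSpace Ω]

theorem memLp_four_iff {P : Measure Ω} {Y : Ω → ℝ} (hY : AEStronglyMeasurable Y P) :
    MemLp Y 4 P ↔ Integrable (fun ω => Y ω ^ 4) P := by
  rw [← integrable_norm_rpow_iff hY (by norm_num) (by norm_num)]
  refine integrable_congr (ae_of_all _ fun ω => ?_)
  have : (4 : ENNReal).toReal = ((4 : ℕ) : ℝ) := by simp
  simp only [this, Real.rpow_natCast, Real.norm_eq_abs]
  exact Even.pow_abs (by decide) _

theorem holderTriple_four : ENNReal.HolderTriple 4 4 2 := ⟨by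
  rw [← two_mul]
  have h : (4 : ENNReal) = 2 * 2 := by norm_num
  rw [h, ENNReal.mul_inv (by norm_num) (by norm_num), ← mul_assoc,
    ENNReal.mul_inv_cancel (by norm_num) (by norm_num), one_mul]⟩

theorem MemLp.mul_four {P : Measure Ω} {Y Z : Ω → ℝ} (hY : MemLp Y 4 P) (hZ : MemLp Z 4 P) :
    MemLp (Y * Z) 2 P :=
  have := holderTriple_four
  hZ.mul hY

theorem MemLp.two_of_four {P : Measure Ω} [IsFiniteMeasure P] {Y : Ω → ℝ} (hY : MemLp Y 4 P) :
    MemLp Y 2 P := hY.mono_exponent (by norm_num)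

namespace GFF

variable (X : GFF d Ω)

theorem memLp_h {f : Euc d → ℝ} (hf : IsTestFun f) : MemLp (X.h 0 1 f) 4 X.P :=
  (memLp_four_iff (X.meas_h 0 1 f).aestronglyMeasurable).mpr (X.mom4 f hf)

theorem tendsto_shell_of_nonneg (hd : 2 ≤ d) {t : ℕ → ℝ} (ht : ∀ n, 3 ≤ t n)
    (htt : Tendsto t atTop atTop) {C : ℝ} (hC : 1 ≤ C) {g : ℕ → Euc d → ℝ}
    (hg : ∀ n, IsTestFun (g n)) (hb : ∀ n x, |g n x| ≤ C * t n)
    (hz : ∀ n x, g n x ≠ 0 → 1 ≤ t n * (1 - ‖x‖ ^ 2) ∧ t n * (1 - ‖x‖ ^ 2) ≤ 2) :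
    Tendsto (fun n => ∫ ω, X.h 0 1 ((2 * C * t n) • sbump (t n) + g n) ω ^ 2 ∂X.P) atTop (𝓝 0) := by
  have ht0 : ∀ n, 0 < t n := fun n => by linarith [ht n]
  set f : ℕ → Euc d → ℝ := fun n => (2 * C * t n) • sbump (t n) + g n with hf
  have hfx : ∀ n x, f n x = 2 * C * t n * sbump (t n) x + g n x := fun n x => rfl
  have hs0 : ∀ n (x : Euc d), 0 ≤ sbump (t n) x := fun n x => shellBump.nonneg
  have hs1 : ∀ n (x : Euc d), sbump (t n) x ≤ 1 := fun n x => shellBump.le_one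
  have hCt : ∀ n, 0 < C * t n := fun n => mul_pos (by linarith) (ht0 n)
  have hcase : ∀ n x, (C * t n ≤ f n x ∧ f n x ≤ 3 * C * t n ∧ 1 ≤ t n * (1 - ‖x‖ ^ 2) ∧
      t n * (1 - ‖x‖ ^ 2) ≤ 2) ∨
      (g n x = 0 ∧ f n x = 2 * C * t n * sbump (t n) x) := fun n x => by
    by_cases h : g n x = 0
    · exact Or.inr ⟨h, by rw [hfx, h, add_zero]⟩
    · obtain ⟨h1, h2⟩ := hz n x h
      have := abs_le.mp (hb n x)
      refine Or.inl ⟨?_, ?_, h1, h2⟩ <;> rw [hfx, sbump_eq_one h1 h2] <;> linarith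
  have hft : ∀ n, IsTestFun (f n) := fun n => ((isTestFun_sbump (ht0 n)).smul _).add (hg n)
  have hnn : ∀ n x, 0 ≤ f n x := fun n x => by
    rcases hcase n x with ⟨h, -⟩ | ⟨-, h⟩
    · exact (hCt n).le.trans h
    · rw [h]; have := mul_nonneg (hCt n).le (hs0 n x); linarith
  have hle : ∀ n x, f n x ≤ 3 * C * t n := fun n x => by
    rcases hcase n x with ⟨-, h, -⟩ | ⟨-, h⟩
    · exact h
    · rw [h]; have := mul_le_mul_of_nonneg_left (hs1 n x) (hCt n).le; linarith [hCt n]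
  have hsupp : ∀ n x, f n x ≠ 0 → 1 / 2 ≤ t n * (1 - ‖x‖ ^ 2) ∧ t n * (1 - ‖x‖ ^ 2) ≤ 5 / 2 :=
    fun n x hx => by
      rcases hcase n x with ⟨-, -, h1, h2⟩ | ⟨-, h⟩
      · constructor <;> linarith
      · by_contra hc
        rw [h, sbump_eq_zero hc, mul_zero] at hx
        exact hx rfl
  refine X.zero_bdry f hft hnn
    ⟨_, fun n => shell_integral_le hd (ht n) (by linarith) (hft n) (hle n) (hsupp n)⟩ ?_ ⟨3, ?_⟩
  · have hlow : ∀ n, 1 - 5 / 2 * (t n)⁻¹ ≤ infDist (0 : Euc d) (tsupport (f n)) ∧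
        infDist (0 : Euc d) (tsupport (f n)) ≤ 1 := fun n => by
      have hr : 0 < 1 - 3 / 2 * (t n)⁻¹ := by
        have : (t n)⁻¹ ≤ 3⁻¹ := inv_anti₀ (by norm_num) (ht n)
        linarith
      have : NeZero d := ⟨by omega⟩
      set p : Euc d := EuclideanSpace.single 0 (√(1 - 3 / 2 * (t n)⁻¹)) with hp
      have hpn : ‖p‖ ^ 2 = 1 - 3 / 2 * (t n)⁻¹ := by
        rw [hp, PiLp.norm_single, Real.norm_eq_abs, sq_abs, Real.sq_sqrt hr.le]
      have hpt : t n * (1 - ‖p‖ ^ 2) = 3 / 2 := by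
        rw [hpn]; have := (ht0 n).ne'; field_simp; ring
      have hfp : f n p ≠ 0 := by
        rcases hcase n p with ⟨h, -⟩ | ⟨-, h⟩
        · exact ((hCt n).trans_le h).ne'
        · rw [h, sbump_eq_one (by linarith) (by linarith)]; linarith [hCt n]
      have hpm : p ∈ tsupport (f n) := subset_tsupport _ hfp
      refine ⟨(le_infDist ⟨p, hpm⟩).mpr fun y hy => ?_, (infDist_le_dist_of_mem hpm).trans ?_⟩
      · have hy' : t n * (1 - ‖y‖ ^ 2) ≤ 5 / 2 :=
          closure_minimal (s := Function.support (f n)) (fun x hx => (hsupp n x hx).2)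
            (isClosed_le (continuous_shell (t n)) continuous_const) hy
        have h1 : 1 - ‖y‖ ^ 2 ≤ 5 / 2 * (t n)⁻¹ := by
          rw [← div_eq_mul_inv, le_div_iff₀ (ht0 n)]; linarith
        rw [dist_zero_left]
        by_contra! hlt
        have := inv_pos.mpr (ht0 n)
        nlinarith [norm_nonneg y]
      · rw [dist_zero_left]
        exact (norm_lt_one_of_shell (ht0 n) (by rw [hpt]; norm_num)).le
    have hlim : Tendsto (fun n => 1 - 5 / 2 * (t n)⁻¹) atTop (𝓝 1) := by
      have := (tendsto_inv_atTop_zero.comp htt).const_mul (5 / 2 : ℝ)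
      simpa using this.const_sub 1
    exact tendsto_of_tendsto_of_tendsto_of_le_of_le hlim tendsto_const_nhds
      (fun n => (hlow n).1) (fun n => (hlow n).2)
  · intro n x y hxy _
    have hsxy : sbump (t n) x = sbump (t n) y := by simp only [sbump, hxy]
    rcases hcase n y with ⟨h1, -, -⟩ | ⟨-, hy⟩
    · linarith [hle n x]
    · rcases hcase n x with ⟨-, h2, h3, h4⟩ | ⟨-, hx⟩
      · rw [hxy] at h3 h4
        rw [hy, sbump_eq_one h3 h4]; linarith [hCt n]
      · rw [hx, hy, hsxy]; have := mul_nonneg (hCt n).le (hs0 n y); linarith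

theorem tendsto_shell (hd : 2 ≤ d) {t : ℕ → ℝ} (ht : ∀ n, 3 ≤ t n)
    (htt : Tendsto t atTop atTop) {C : ℝ} (hC : 1 ≤ C) {g : ℕ → Euc d → ℝ}
    (hg : ∀ n, IsTestFun (g n)) (hb : ∀ n x, |g n x| ≤ C * t n)
    (hz : ∀ n x, g n x ≠ 0 → 1 ≤ t n * (1 - ‖x‖ ^ 2) ∧ t n * (1 - ‖x‖ ^ 2) ≤ 2) :
    Tendsto (fun n => ∫ ω, X.h 0 1 (g n) ω ^ 2 ∂X.P) atTop (𝓝 0) := by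
  have ht0 : ∀ n, 0 < t n := fun n => by linarith [ht n]
  have h1 := X.tendsto_shell_of_nonneg hd ht htt hC hg hb hz
  have h0 := X.tendsto_shell_of_nonneg hd ht htt hC (g := fun _ => 0)
    (fun n => ⟨contDiff_const, HasCompactSupport.zero⟩)
    (fun n x => by simpa using mul_nonneg (by linarith : (0 : ℝ) ≤ C) (ht0 n).le)
    (fun n x h => (h rfl).elim)
  have h2 := (h1.const_mul 2).add (h0.const_mul 2)
  rw [mul_zero, add_zero] at h2
  refine squeeze_zero (fun n => integral_nonneg fun ω => sq_nonneg _) (fun n => ?_) h2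
  have hs : IsTestFun ((2 * C * t n) • sbump (t n) : Euc d → ℝ) := (isTestFun_sbump (ht0 n)).smul _
  have e := X.lin_add _ _ hs (hg n)
  simp only [add_zero]
  rw [← integral_const_mul, ← integral_const_mul, ← integral_add]
  · refine integral_mono_ae (MemLp.two_of_four (X.memLp_h (hg n))).integrable_sq ?_ ?_
    · exact ((MemLp.two_of_four (X.memLp_h (hs.add (hg n)))).integrable_sq.const_mul 2).add
        ((MemLp.two_of_four (X.memLp_h hs)).integrable_sq.const_mul 2)
    · filter_upwards [e] with ω hω
      rw [hω]
      nlinarith [sq_nonneg (X.h 0 1 ((2 * C * t n) • sbump (t n)) ω * 2 + X.h 0 1 (g n) ω)]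
  · exact (MemLp.two_of_four (X.memLp_h (hs.add (hg n)))).integrable_sq.const_mul 2
  · exact (MemLp.two_of_four (X.memLp_h hs)).integrable_sq.const_mul 2

/-- The boundary error of the cut-off Green potential is negligible in mean square. -/
theorem exists_bdryErr_tendsto (hd : 2 ≤ d) {ε : ℝ} (hε : 0 < ε) {y : Euc d} (hy : ε < 1 - ‖y‖) :
    ∃ t : ℕ → ℝ, (∀ n, 3 ≤ t n) ∧ Tendsto t atTop atTop ∧
      (∀ n x, ‖x - y‖ ≤ ε → 2 < t n * (1 - ‖x‖ ^ 2)) ∧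
      Tendsto (fun n => ∫ ω, X.h 0 1 (bdryErr ε y (t n)) ω ^ 2 ∂X.P) atTop (𝓝 0) := by
  obtain ⟨C, T, hC, hT, h⟩ := exists_bdryErr_bounds hε hy
  have htT : ∀ n : ℕ, T ≤ T + n := fun n => by simp
  have htt : Tendsto (fun n : ℕ => T + (n : ℝ)) atTop atTop :=
    tendsto_atTop_add_const_left _ _ tendsto_natCast_atTop_atTop
  have ht3 : ∀ n : ℕ, 3 ≤ T + (n : ℝ) := fun n => hT.trans (htT n)
  exact ⟨fun n => T + n, ht3, htt, fun n => (h _ (htT n)).2.2,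
    X.tendsto_shell hd ht3 htt hC (fun n => isTestFun_bdryErr hε y (by linarith [ht3 n]))
      (fun n => (h _ (htT n)).1) (fun n => (h _ (htT n)).2.1)⟩

end GFF

/-- The homeomorphism `x ↦ r x + a`. -/
def affineHomeo (a : Euc d) {r : ℝ} (hr : r ≠ 0) : Euc d ≃ₜ Euc d :=
  (Homeomorph.smulOfNeZero r hr).trans (Homeomorph.addRight a)

theorem IsTestFun.comp_affine {f : Euc d → ℝ} (hf : IsTestFun f) (a : Euc d) {r : ℝ} (hr : r ≠ 0) :
    IsTestFun fun x => f (r • x + a) :=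
  ⟨hf.1.comp ((contDiff_id.const_smul r).add contDiff_const),
    hf.2.comp_homeomorph (affineHomeo a hr)⟩

theorem tsupport_comp_affine (f : Euc d → ℝ) (a : Euc d) {r : ℝ} (hr : r ≠ 0) :
    tsupport (fun x => f (r • x + a)) = (fun x => r • x + a) ⁻¹' tsupport f :=
  tsupport_comp_eq_preimage f (affineHomeo a hr)

theorem preimage_affine_ball (a : Euc d) {r : ℝ} (hr : 0 < r) :
    (fun x : Euc d => r • x + a) ⁻¹' ball a r = ball 0 1 := by
  ext x
  simp only [mem_preimage, mem_ball_iff_norm, add_sub_cancel_right, sub_zero, norm_smul,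
    Real.norm_eq_abs, abs_of_pos hr]
  exact ⟨fun h => by nlinarith, fun h => by nlinarith⟩

namespace GFF

variable (X : GFF d Ω)

/-- The sigma-algebra of the local part of the field. -/
abbrev mH (a : Euc d) (r : ℝ) : MeasurableSpace Ω :=
  ⨆ f : {f : Euc d → ℝ // IsTestFun f}, MeasurableSpace.comap (X.H a r f.1) inferInstance

/-- The sigma-algebra of the harmonic part of the field. -/
abbrev mΦ (a : Euc d) (r : ℝ) : MeasurableSpace Ω :=
  (⨆ f : {f : Euc d → ℝ // IsTestFun f}, MeasurableSpace.comap (X.Φ a r f.1) inferInstance) ⊔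
    (⨆ z : Euc d, MeasurableSpace.comap (fun ω => X.φharm a r ω z) inferInstance)

theorem mH_le (a : Euc d) (r : ℝ) : X.mH a r ≤ ‹MeasurableSpace Ω› :=
  iSup_le fun f => (X.meas_H a r f.1).comap_le

theorem mΦ_le (a : Euc d) (r : ℝ) : X.mΦ a r ≤ ‹MeasurableSpace Ω› :=
  sup_le (iSup_le fun f => (X.meas_Φ a r f.1).comap_le)
    (iSup_le fun z => (X.meas_φharm a r z).comap_le)

theorem measurable_H_mH (a : Euc d) (r : ℝ) {f : Euc d → ℝ} (hf : IsTestFun f) :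
    Measurable[X.mH a r] (X.H a r f) :=
  Measurable.mono (comap_measurable (X.H a r f))
    (le_iSup (fun f : {f : Euc d → ℝ // IsTestFun f} =>
      MeasurableSpace.comap (X.H a r f.1) inferInstance) ⟨f, hf⟩) le_rfl

theorem measurable_Φ_mΦ (a : Euc d) (r : ℝ) {f : Euc d → ℝ} (hf : IsTestFun f) :
    Measurable[X.mΦ a r] (X.Φ a r f) :=
  Measurable.mono (comap_measurable (X.Φ a r f))
    ((le_iSup (fun f : {f : Euc d → ℝ // IsTestFun f} =>
      MeasurableSpace.comap (X.Φ a r f.1) inferInstance) ⟨f, hf⟩).trans le_sup_left) le_rfl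

variable {a : Euc d} {r : ℝ}

theorem integral_mul_of_indep (hr : 0 < r) (hD : ball a r ⊆ ball 0 1) {Z Y : Ω → ℝ}
    (hZ : Measurable[X.mH a r] Z) (hY : AEStronglyMeasurable[X.mΦ a r] Y X.P) :
    ∫ ω, Z ω * Y ω ∂X.P = (∫ ω, Z ω ∂X.P) * ∫ ω, Y ω ∂X.P := by
  obtain ⟨Y', hY', hYY'⟩ := hY
  have hind : IndepFun Z Y' X.P := by
    rw [IndepFun_iff_Indep]
    exact indep_of_indep_of_le_left (indep_of_indep_of_le_right (X.dmp_indep a r hr hD)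
      hY'.measurable.comap_le) hZ.comap_le
  rw [integral_congr_ae hYY', ← hind.integral_fun_mul_eq_mul_integral
    (hZ.mono (X.mH_le a r) le_rfl).aestronglyMeasurable
    (hY'.mono (X.mΦ_le a r)).aestronglyMeasurable]
  exact integral_congr_ae (hYY'.mono fun ω h => by simp only [h])

theorem identDistrib_H (hr : 0 < r) (hD : ball a r ⊆ ball 0 1) (k : ℕ) (f : Fin k → Euc d → ℝ)
    (hf : ∀ i, IsTestFun (f i)) :
    IdentDistrib (fun ω (i : Fin k) => X.H a r (f i) ω)
      (fun ω (i : Fin k) => r ^ (1 + (d : ℝ) / 2) * X.h 0 1 (fun x => f i (r • x + a)) ω)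
      X.P X.P := by
  refine ⟨(measurable_pi_lambda _ fun i => X.meas_H a r _).aemeasurable,
    (measurable_pi_lambda _ fun i => (X.meas_h 0 1 _).const_mul _).aemeasurable, ?_⟩
  have h1 := X.dmp_law a r hr hD k f hf
  have h2 := X.scaling a r hr k (fun i x => f i (r • x + a)) (fun i => (hf i).comp_affine a hr.ne')
  rw [h1, ← h2]
  congr! with ω i x
  simp [smul_smul, mul_inv_cancel₀ hr.ne']

theorem identDistrib_H_one (hr : 0 < r) (hD : ball a r ⊆ ball 0 1) {f : Euc d → ℝ}
    (hf : IsTestFun f) :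
    IdentDistrib (X.H a r f)
      (fun ω => r ^ (1 + (d : ℝ) / 2) * X.h 0 1 (fun x => f (r • x + a)) ω) X.P X.P :=
  (X.identDistrib_H hr hD 1 (fun _ => f) fun _ => hf).comp (measurable_pi_apply (0 : Fin 1))

theorem memLp_H (hr : 0 < r) (hD : ball a r ⊆ ball 0 1) {f : Euc d → ℝ}
    (hf : IsTestFun f) : MemLp (X.H a r f) 4 X.P :=
  (X.identDistrib_H_one hr hD hf).memLp_iff.mpr ((X.memLp_h (hf.comp_affine a hr.ne')).const_mul _)

theorem integral_H (hr : 0 < r) (hD : ball a r ⊆ ball 0 1) {f : Euc d → ℝ}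
    (hf : IsTestFun f) : ∫ ω, X.H a r f ω ∂X.P = 0 := by
  rw [(X.identDistrib_H_one hr hD hf).integral_eq, integral_const_mul,
    X.centered 0 1 _ (hf.comp_affine a hr.ne'), mul_zero]

theorem H_add (hr : 0 < r) (hD : ball a r ⊆ ball 0 1) {f g : Euc d → ℝ}
    (hf : IsTestFun f) (hg : IsTestFun g) :
    X.H a r (f + g) =ᵐ[X.P] X.H a r f + X.H a r g := by
  have h := X.identDistrib_H hr hD 3 ![f, g, f + g] (fun i => by
    fin_cases i
    exacts [hf, hg, hf.add hg])
  have := h.symm.ae_snd (p := fun v => v 2 = v 0 + v 1)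
    (measurableSet_eq_fun (measurable_pi_apply 2) (by fun_prop)) (by
      filter_upwards [X.lin_add _ _ (hf.comp_affine a hr.ne') (hg.comp_affine a hr.ne')] with ω hω
      have e : (fun x => f (r • x + a)) + (fun x => g (r • x + a)) =
        fun x => (![f, g, f + g] : Fin 3 → Euc d → ℝ) 2 (r • x + a) := rfl
      rw [e] at hω
      simp only [hω, Matrix.cons_val_zero, Matrix.cons_val_one]
      ring)
  filter_upwards [this] with ω hω
  exact hω

theorem H_smul (hr : 0 < r) (hD : ball a r ⊆ ball 0 1) {f : Euc d → ℝ} (c : ℝ)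
    (hf : IsTestFun f) : X.H a r (c • f) =ᵐ[X.P] c • X.H a r f := by
  have h := X.identDistrib_H hr hD 2 ![f, c • f] (fun i => by
    fin_cases i
    exacts [hf, hf.smul c])
  have := h.symm.ae_snd (p := fun v => v 1 = c * v 0)
    (measurableSet_eq_fun (measurable_pi_apply 1) (by fun_prop)) (by
      filter_upwards [X.lin_smul c _ (hf.comp_affine a hr.ne')] with ω hω
      have e : c • (fun x => f (r • x + a)) =
        fun x => (![f, c • f] : Fin 2 → Euc d → ℝ) 1 (r • x + a) := rfl
      rw [e] at hω
      simp only [hω, Matrix.cons_val_zero]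
      ring)
  filter_upwards [this] with ω hω
  exact hω

theorem H_eq_zero (hr : 0 < r) (hD : ball a r ⊆ ball 0 1) {f : Euc d → ℝ}
    (hf : IsTestFun f) (hs : Disjoint (tsupport f) (ball a r)) :
    X.H a r f =ᵐ[X.P] 0 := by
  have h := X.identDistrib_H_one hr hD hf
  have := h.symm.ae_snd (p := fun v => v = 0) (measurableSet_singleton 0) (by
    have hz := X.zero_outside _ (hf.comp_affine a hr.ne') (by
      rw [tsupport_comp_affine f a hr.ne', ← preimage_affine_ball a hr, ← preimage_compl]
      exact preimage_mono hs.subset_compl_right)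
    filter_upwards [hz] with ω hω
    rw [hω, mul_zero])
  exact this

theorem integral_H_mul_H (hr : 0 < r) (hD : ball a r ⊆ ball 0 1) {f g : Euc d → ℝ}
    (hf : IsTestFun f) (hg : IsTestFun g) :
    ∫ ω, X.H a r f ω * X.H a r g ω ∂X.P = r ^ (d + 2) *
      ∫ ω, X.h 0 1 (fun x => f (r • x + a)) ω * X.h 0 1 (fun x => g (r • x + a)) ω ∂X.P := by
  have h := X.identDistrib_H hr hD 2 ![f, g] (fun i => by
    fin_cases i
    exacts [hf, hg])
  have h' := (h.comp (u := fun v => v 0 * v 1) (by fun_prop)).integral_eq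
  simp only [Function.comp_def, Matrix.cons_val_zero, Matrix.cons_val_one] at h'
  rw [h', ← integral_const_mul]
  congr 1 with ω
  have e : r ^ (d + 2) = r ^ (1 + (d : ℝ) / 2) * r ^ (1 + (d : ℝ) / 2) := by
    rw [← Real.rpow_add hr, ← Real.rpow_natCast]
    congr 1
    push_cast
    ring
  rw [e]
  ring

theorem h_eq (hr : 0 < r) (hD : ball a r ⊆ ball 0 1) {f : Euc d → ℝ} (hf : IsTestFun f) :
    X.h 0 1 f =ᵐ[X.P] X.H a r f + X.Φ a r f := X.dmp_decomp a r hr hD f hf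

theorem h_ae_eq_Φ (hr : 0 < r) (hD : ball a r ⊆ ball 0 1) {f : Euc d → ℝ}
    (hf : IsTestFun f) (hs : Disjoint (tsupport f) (ball a r)) :
    X.h 0 1 f =ᵐ[X.P] X.Φ a r f := by
  filter_upwards [X.h_eq hr hD hf, X.H_eq_zero hr hD hf hs] with ω h1 h2
  rw [h1, Pi.add_apply, h2, Pi.zero_apply, zero_add]

theorem aestronglyMeasurable_h (hr : 0 < r) (hD : ball a r ⊆ ball 0 1) {f : Euc d → ℝ}
    (hf : IsTestFun f) (hs : Disjoint (tsupport f) (ball a r)) :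
    AEStronglyMeasurable[X.mΦ a r] (X.h 0 1 f) X.P :=
  ⟨X.Φ a r f, (X.measurable_Φ_mΦ a r hf).stronglyMeasurable, X.h_ae_eq_Φ hr hD hf hs⟩

theorem h_ae_eq_H (hr : 0 < r) (hD : ball a r ⊆ ball 0 1) {g : Euc d → ℝ}
    (hg : IsTestFun g) (hs : tsupport g ⊆ ball a r) :
    X.h 0 1 (lap g) =ᵐ[X.P] X.H a r (lap g) := by
  filter_upwards [X.h_eq hr hD hg.lap, X.dmp_harm a r hr hD] with ω h1 h2
  rw [h1, Pi.add_apply, h2.2 _ hg.lap ((tsupport_lap_subset g).trans hs),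
    h2.1.integral_mul_lap isOpen_ball hg hs, add_zero]

theorem memLp_Φ (hr : 0 < r) (hD : ball a r ⊆ ball 0 1) {f : Euc d → ℝ}
    (hf : IsTestFun f) : MemLp (X.Φ a r f) 4 X.P := by
  refine ((X.memLp_h hf).sub (X.memLp_H hr hD hf)).ae_eq ?_
  filter_upwards [X.h_eq hr hD hf] with ω h1
  rw [Pi.sub_apply, h1, Pi.add_apply, add_sub_cancel_left]

theorem integral_lap_mul_eq_zero (hr : 0 < r) (hD : ball a r ⊆ ball 0 1) {g : Euc d → ℝ}
    (hg : IsTestFun g) (hs : tsupport g ⊆ ball a r) {Y : Ω → ℝ}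
    (hY : AEStronglyMeasurable[X.mΦ a r] Y X.P) :
    ∫ ω, X.h 0 1 (lap g) ω * Y ω ∂X.P = 0 := by
  rw [integral_congr_ae ((X.h_ae_eq_H hr hD hg hs).mono fun ω h => congrArg (· * Y ω) h),
    X.integral_mul_of_indep hr hD (X.measurable_H_mH a r hg.lap) hY, X.integral_H hr hD hg.lap,
    zero_mul]

theorem φharm_ae (hr : 0 < r) (hD : ball a r ⊆ ball 0 1) :
    (fun ω => molMass d * X.φharm a r ω a) =ᵐ[X.P] X.Φ a r (mol (r / 2) a) := by
  filter_upwards [X.dmp_harm a r hr hD] with ω h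
  rw [h.2 _ (isTestFun_mol (by linarith) a)
    ((tsupport_mol (by linarith) a).trans (closedBall_subset_ball (by linarith))),
    h.1.integral_mul_mol (by linarith) (by linarith)]

end GFF

theorem MemLp.eLpNorm_two_eq {α : Type*} {m0 : MeasurableSpace α} {P : Measure α} {f : α → ℝ} (hf : MemLp f 2 P) :
    eLpNorm f 2 P = ENNReal.ofReal (√(∫ ω, f ω ^ 2 ∂P)) := by
  rw [hf.eLpNorm_eq_integral_rpow_norm (by norm_num) (by norm_num), Real.sqrt_eq_rpow]
  simp

theorem abs_integral_mul_le_sqrt {P : Measure Ω} {f g : Ω → ℝ} (hf : MemLp f 2 P)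
    (hg : MemLp g 2 P) :
    |∫ ω, f ω * g ω ∂P| ≤ √(∫ ω, f ω ^ 2 ∂P) * √(∫ ω, g ω ^ 2 ∂P) := by
  have h := integral_mul_norm_le_Lp_mul_Lq (μ := P) (f := f) (g := g) Real.HolderConjugate.two_two
    (by simpa using hf) (by simpa using hg)
  refine (abs_integral_le_integral_abs (f := fun ω => f ω * g ω)).trans ?_
  rw [Real.sqrt_eq_rpow, Real.sqrt_eq_rpow]
  simpa [abs_mul] using h

theorem aestronglyMeasurable_of_tendsto_ae_of_le {α : Type*} {m m0 : MeasurableSpace α}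
    {P : Measure[m0] α} {f : ℕ → α → ℝ} {g : α → ℝ} (hf : ∀ n, AEStronglyMeasurable[m] (f n) P)
    (hlim : ∀ᵐ ω ∂P, Tendsto (fun n => f n ω) atTop (𝓝 (g ω))) :
    AEStronglyMeasurable[m] g P := by
  refine ⟨fun ω => limUnder atTop fun n => (hf n).mk (f n) ω,
    @StronglyMeasurable.limUnder _ _ _ m _ _ _ _ _ _ _ fun n => (hf n).stronglyMeasurable_mk, ?_⟩
  filter_upwards [hlim, ae_all_iff.mpr fun n => (hf n).ae_eq_mk] with ω h1 h2
  simp only [h2] at h1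
  exact h1.limUnder_eq.symm

theorem aestronglyMeasurable_of_tendsto_sq {α : Type*} {m m0 : MeasurableSpace α}
    {P : Measure[m0] α} {f : ℕ → α → ℝ} {g : α → ℝ} (hf : ∀ n, AEStronglyMeasurable[m] (f n) P)
    (hf2 : ∀ n, MemLp (f n) 2 P) (hg2 : MemLp g 2 P)
    (hlim : Tendsto (fun n => ∫ ω, (f n ω - g ω) ^ 2 ∂P) atTop (𝓝 0)) :
    AEStronglyMeasurable[m] g P := by
  have h : TendstoInMeasure P f atTop g := by
    refine tendstoInMeasure_of_tendsto_eLpNorm_of_ne_top (p := 2) (by norm_num) (by norm_num)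
      (fun n => (hf2 n).1) hg2.1 ?_
    simp only [MemLp.eLpNorm_two_eq ((hf2 _).sub hg2), Pi.sub_apply]
    have := (Real.continuous_sqrt.tendsto 0).comp hlim
    rw [Real.sqrt_zero] at this
    have h2 := (ENNReal.continuous_ofReal.tendsto 0).comp this
    rwa [ENNReal.ofReal_zero] at h2
  obtain ⟨ns, -, hns⟩ := h.exists_seq_tendsto_ae
  exact aestronglyMeasurable_of_tendsto_ae_of_le (fun n => hf (ns n)) hns

theorem mol_comp_affine {ε r : ℝ} (hε : 0 < ε) (hr : 0 < r) (z x : Euc d) :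
    mol (r * ε) z (r • x + z) = (r ^ d)⁻¹ * mol ε 0 x := by
  have h : ‖r • x + z - z‖ ^ 2 = r ^ 2 * ‖x‖ ^ 2 := by
    rw [add_sub_cancel_right, norm_smul, mul_pow, Real.norm_eq_abs, sq_abs]
  rw [mol, mol, h, sub_zero]
  rcases eq_or_lt_of_le (sq_nonneg ‖x‖) with h0 | h0
  · rw [← h0, mul_zero, radB_of_lt d (mul_pos hr hε) (by positivity),
      radB_of_lt d hε (by positivity), mul_zero, mul_zero]
  · rw [radB_scale d hε hr h0]; ring

/-- A fixed cutoff function on the unit ball. -/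
def cbump : ContDiffBump (0 : Euc d) := ⟨3 / 4, 7 / 8, by norm_num, by norm_num⟩

/-- The cutoff function of the ball with centre `z` and radius `a`. -/
def cutoff (z : Euc d) (a : ℝ) (x : Euc d) : ℝ := cbump (a⁻¹ • x + -(a⁻¹ • z))

theorem isTestFun_cbump : IsTestFun (cbump : Euc d → ℝ) :=
  ⟨cbump.contDiff, cbump.hasCompactSupport⟩

theorem isTestFun_cutoff (z : Euc d) {a : ℝ} (ha : 0 < a) : IsTestFun (cutoff z a) :=
  isTestFun_cbump.comp_affine _ (inv_pos.mpr ha).ne'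

theorem cutoff_comp_affine (z : Euc d) {a : ℝ} (ha : 0 < a) (x : Euc d) :
    cutoff z a (a • x + z) = cbump x := by
  simp [cutoff, smul_smul, inv_mul_cancel₀ ha.ne']

theorem norm_inv_smul_sub {a : ℝ} (ha : 0 < a) (x z : Euc d) :
    ‖a⁻¹ • x + -(a⁻¹ • z)‖ = ‖x - z‖ / a := by
  rw [← sub_eq_add_neg, ← smul_sub, norm_smul, norm_inv, Real.norm_eq_abs, abs_of_pos ha,
    div_eq_inv_mul]

theorem cutoff_eq_one {z x : Euc d} {a : ℝ} (ha : 0 < a) (h : ‖x - z‖ ≤ 3 / 4 * a) :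
    cutoff z a x = 1 := by
  refine cbump.one_of_mem_closedBall ?_
  rw [mem_closedBall_zero_iff, norm_inv_smul_sub ha, div_le_iff₀ ha]
  exact h

theorem cutoff_eq_zero {z x : Euc d} {a : ℝ} (ha : 0 < a) (h : 7 / 8 * a ≤ ‖x - z‖) :
    cutoff z a x = 0 := by
  refine cbump.zero_of_le_dist ?_
  rw [dist_zero_right, norm_inv_smul_sub ha, le_div_iff₀ ha]
  exact h

theorem tsupport_cutoff_subset (z : Euc d) {a : ℝ} (ha : 0 < a) :
    tsupport (cutoff z a) ⊆ closedBall z (7 / 8 * a) :=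
  closure_minimal (fun x hx => by
    rw [mem_closedBall_iff_norm]
    by_contra h
    exact hx (cutoff_eq_zero ha (not_le.mp h).le)) isClosed_closedBall

namespace GFF

variable (X : GFF d Ω)

/-- The pairing of the field with a Laplacian, tested against a random variable. -/
def lapPair (Y : Ω → ℝ) (g : Euc d → ℝ) : ℝ := ∫ ω, X.h 0 1 (lap g) ω * Y ω ∂X.P

theorem integrable_h_mul {f : Euc d → ℝ} (hf : IsTestFun f) {Y : Ω → ℝ} (hY : MemLp Y 2 X.P) :
    Integrable (fun ω => X.h 0 1 f ω * Y ω) X.P :=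
  (MemLp.two_of_four (X.memLp_h hf)).integrable_mul hY

theorem lapPair_add {Y : Ω → ℝ} (hY : MemLp Y 2 X.P) {f g : Euc d → ℝ}
    (hf : IsTestFun f) (hg : IsTestFun g) :
    X.lapPair Y (f + g) = X.lapPair Y f + X.lapPair Y g := by
  rw [lapPair, lapPair, lapPair, ← integral_add (X.integrable_h_mul hf.lap hY)
    (X.integrable_h_mul hg.lap hY), lap_add hf.1 hg.1]
  refine integral_congr_ae ?_
  filter_upwards [X.lin_add _ _ hf.lap hg.lap] with ω hω
  rw [hω, add_mul]

theorem isTestFun_zero : IsTestFun (0 : Euc d → ℝ) := ⟨contDiff_const, HasCompactSupport.zero⟩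

theorem lapPair_sum {Y : Ω → ℝ} (hY : MemLp Y 2 X.P) {ι : Type*} (s : Finset ι)
    (g : ι → Euc d → ℝ) (hg : ∀ i ∈ s, IsTestFun (g i)) :
    IsTestFun (∑ i ∈ s, g i) ∧ X.lapPair Y (∑ i ∈ s, g i) = ∑ i ∈ s, X.lapPair Y (g i) := by
  classical
  induction s using Finset.induction_on with
  | empty =>
    refine ⟨isTestFun_zero, ?_⟩
    have := X.lapPair_add hY isTestFun_zero isTestFun_zero
    rw [add_zero] at this
    simpa using this
  | insert i s hi ih =>
    obtain ⟨h1, h2⟩ := ih fun j hj => hg j (Finset.mem_insert_of_mem hj)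
    have h3 := hg i (Finset.mem_insert_self i s)
    rw [Finset.sum_insert hi, Finset.sum_insert hi, X.lapPair_add hY h3 h1, h2]
    exact ⟨h3.add h1, rfl⟩

/-- Integration by parts against random variables which only see the field near finitely many
points. -/
theorem integral_mol_mul (hd : 2 ≤ d) {ε : ℝ} (hε : 0 < ε) {y : Euc d} (hy : ε < 1 - ‖y‖)
    {ι : Type*} (s : Finset ι) (z : ι → Euc d) (a : ι → ℝ) (ha : ∀ j ∈ s, 0 < a j)
    (hball : ∀ j ∈ s, ball (z j) (a j) ⊆ ball 0 1)
    (hdisj : ∀ i ∈ s, ∀ j ∈ s, i ≠ j → Disjoint (ball (z i) (a i)) (ball (z j) (a j)))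
    {Y : Ω → ℝ} (hY : MemLp Y 2 X.P)
    (hYm : ∀ b ρ, 0 < ρ → ball b ρ ⊆ ball 0 1 →
      (∀ j ∈ s, Disjoint (ball b ρ) (closedBall (z j) (a j / 2))) →
      AEStronglyMeasurable[X.mΦ b ρ] Y X.P) :
    ∫ ω, X.h 0 1 (mol ε y) ω * Y ω ∂X.P =
      -∑ j ∈ s, X.lapPair Y (greenPot ε y * cutoff (z j) (a j)) := by
  classical
  obtain ⟨t, ht, htt, -, hlim⟩ := X.exists_bdryErr_tendsto hd hε hy
  have ht0 : ∀ n, 0 < t n := fun n => by linarith [ht n]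
  have hcut : ∀ j ∈ s, IsTestFun (greenPot ε y * cutoff (z j) (a j)) := fun j hj =>
    (isTestFun_cutoff _ (ha j hj)).contDiff_mul (contDiff_greenPot hε y)
  have hmol := isTestFun_mol hε y
  have hfull := fun n => isTestFun_greenPot_mul_bcut hε y (ht0 n)
  have herr := fun n => isTestFun_bdryErr hε y (ht0 n)
  -- the boundary term
  have hE : Tendsto (fun n => ∫ ω, X.h 0 1 (bdryErr ε y (t n)) ω * Y ω ∂X.P) atTop (𝓝 0) := by
    refine squeeze_zero_norm (fun n => abs_integral_mul_le_sqrt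
      (MemLp.two_of_four (X.memLp_h (herr n))) hY) ?_
    have := (Real.continuous_sqrt.tendsto 0).comp hlim
    rw [Real.sqrt_zero] at this
    simpa using this.mul_const (√(∫ ω, Y ω ^ 2 ∂X.P))
  have hsplit : ∀ n, ∫ ω, X.h 0 1 (bdryErr ε y (t n)) ω * Y ω ∂X.P =
      X.lapPair Y (greenPot ε y * bcut (t n)) + ∫ ω, X.h 0 1 (mol ε y) ω * Y ω ∂X.P := fun n => by
    rw [lapPair, ← integral_add (X.integrable_h_mul (hfull n).lap hY) (X.integrable_h_mul hmol hY)]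
    refine integral_congr_ae ?_
    filter_upwards [X.lin_add _ _ (hfull n).lap hmol] with ω hω
    rw [bdryErr, hω, add_mul]
  -- the cutoff at the boundary is eventually invisible near the points
  have hev : ∀ᶠ n in atTop, ∀ j ∈ s, ∀ x, bcut (t n) x * cutoff (z j) (a j) x =
      cutoff (z j) (a j) x := by
    rw [Filter.eventually_all_finset]
    intro j hj
    obtain ⟨R, ⟨hR0, hR1⟩, hR⟩ := exists_pos_lt_subset_ball one_pos isClosed_closedBall
      ((closedBall_subset_ball (by linarith [ha j hj])).trans (hball j hj) :
        closedBall (z j) (7 / 8 * a j) ⊆ ball 0 1)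
    have hR2 : 0 < 1 - R ^ 2 := by nlinarith
    filter_upwards [htt.eventually_ge_atTop (2 / (1 - R ^ 2))] with n hn x
    by_cases hx : cutoff (z j) (a j) x = 0
    · rw [hx, mul_zero]
    · have h1 := hR (tsupport_cutoff_subset (z j) (ha j hj) (subset_tsupport _ hx))
      rw [mem_ball_zero_iff] at h1
      rw [bcut_of_ge, one_mul]
      rw [div_le_iff₀ hR2] at hn
      have : ‖x‖ ^ 2 ≤ R ^ 2 := by gcongr
      nlinarith [ht0 n]
  set U : Set (Euc d) := ball 0 1 ∩ ⋂ j ∈ s, (closedBall (z j) (a j / 2))ᶜ with hU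
  have hUo : IsOpen U := isOpen_ball.inter
    (isOpen_biInter_finset fun j _ => isClosed_closedBall.isOpen_compl)
  have hloc : ∀ x ∈ U, ∃ ρ > 0, ∀ g, IsTestFun g → tsupport g ⊆ ball x ρ →
      X.lapPair Y g = 0 := fun x hx => by
    obtain ⟨ρ, hρ, hsub⟩ := Metric.isOpen_iff.mp hUo x hx
    have hb : ball x ρ ⊆ ball 0 1 := hsub.trans inter_subset_left
    refine ⟨ρ, hρ, fun g hg hgs => X.integral_lap_mul_eq_zero hρ hb hg hgs
      (hYm x ρ hρ hb fun j hj => ?_)⟩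
    refine Set.disjoint_left.mpr fun w hw => ?_
    exact Set.mem_iInter₂.mp (hsub hw).2 j hj
  have hmain : ∀ᶠ n in atTop, X.lapPair Y (greenPot ε y * bcut (t n)) =
      ∑ j ∈ s, X.lapPair Y (greenPot ε y * cutoff (z j) (a j)) := by
    filter_upwards [hev] with n hn
    obtain ⟨hsT, hsum⟩ := X.lapPair_sum hY s _ hcut
    set R : Euc d → ℝ := greenPot ε y * bcut (t n) -
      ∑ j ∈ s, greenPot ε y * cutoff (z j) (a j) with hR
    have hRT : IsTestFun R := (hfull n).sub hsT
    have hRx : ∀ x, R x = greenPot ε y x * (1 - ∑ j ∈ s, cutoff (z j) (a j) x) * bcut (t n) x :=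
      fun x => by
        simp only [hR, Pi.sub_apply, Pi.mul_apply, Finset.sum_apply]
        rw [← Finset.mul_sum, mul_assoc, sub_mul, one_mul, Finset.sum_mul, mul_sub]
        congr 2
        exact Finset.sum_congr rfl fun j hj => by rw [mul_comm (cutoff _ _ _), hn j hj]
    have hRU : tsupport R ⊆ U := fun x hx => by
      refine ⟨?_, Set.mem_iInter₂.mpr fun j hj hxj => ?_⟩
      · refine tsupport_bcut_subset_ball (ht0 n) (closure_mono (fun w hw => ?_) hx)
        intro h0
        exact hw (by rw [hRx, h0, mul_zero])
      · refine (notMem_tsupport_iff_eventuallyEq.mpr ?_) hx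
        have : ball (z j) (3 / 4 * a j) ∈ 𝓝 x := isOpen_ball.mem_nhds (by
          rw [mem_closedBall] at hxj
          rw [mem_ball]
          linarith [ha j hj])
        filter_upwards [this] with w hw
        rw [mem_ball_iff_norm] at hw
        have h1 : ∑ i ∈ s, cutoff (z i) (a i) w = 1 := by
          rw [Finset.sum_eq_single_of_mem j hj, cutoff_eq_one (ha j hj) hw.le]
          intro i hi hij
          refine cutoff_eq_zero (ha i hi) ?_
          by_contra hlt
          have h3 : w ∈ ball (z i) (a i) := by
            rw [mem_ball_iff_norm]
            linarith [ha i hi]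
          have h4 : w ∈ ball (z j) (a j) := by
            rw [mem_ball_iff_norm]
            linarith [ha j hj]
          exact Set.disjoint_left.mp (hdisj i hi j hj hij) h3 h4
        rw [hRx, h1, sub_self, mul_zero, zero_mul]
        rfl
    have hR0 := eq_zero_of_locally_eq_zero (X.lapPair Y)
      (fun f g hf hg => X.lapPair_add hY hf hg) hloc hRT hRU
    have : greenPot ε y * bcut (t n) = R + ∑ j ∈ s, greenPot ε y * cutoff (z j) (a j) := by
      rw [hR, sub_add_cancel]
    rw [this, X.lapPair_add hY hRT hsT, hR0, zero_add, hsum]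
  have hconst : Tendsto (fun n => ∫ ω, X.h 0 1 (bdryErr ε y (t n)) ω * Y ω ∂X.P) atTop
      (𝓝 (∑ j ∈ s, X.lapPair Y (greenPot ε y * cutoff (z j) (a j)) +
        ∫ ω, X.h 0 1 (mol ε y) ω * Y ω ∂X.P)) := by
    refine tendsto_const_nhds.congr' ?_
    filter_upwards [hmain] with n hn
    rw [hsplit, hn]
  linarith [tendsto_nhds_unique hE hconst]

variable {a : Euc d} {r : ℝ}

/-- The local part tested against the central mollifier is a limit of field values tested inside
the ball. -/
theorem aestronglyMeasurable_H_mol (hd : 2 ≤ d) (hr : 0 < r) (hD : ball a r ⊆ ball 0 1)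
    {b : Euc d} {ρ : ℝ}
    (hmeas : ∀ g, IsTestFun g → tsupport g ⊆ ball a r →
      AEStronglyMeasurable[X.mΦ b ρ] (X.h 0 1 g) X.P) :
    AEStronglyMeasurable[X.mΦ b ρ] (X.H a r (mol (r / 2) a)) X.P := by
  have hhalf : (0 : ℝ) < 1 / 2 := by norm_num
  obtain ⟨t, ht, -, -, hlim⟩ := X.exists_bdryErr_tendsto hd hhalf (y := (0 : Euc d))
    (by norm_num)
  have ht0 : ∀ n, 0 < t n := fun n => by linarith [ht n]
  set g : ℕ → Euc d → ℝ := fun n => greenPot (1 / 2) (0 : Euc d) * bcut (t n) with hg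
  have hgt : ∀ n, IsTestFun (g n) := fun n => isTestFun_greenPot_mul_bcut hhalf 0 (ht0 n)
  have hri := (inv_pos.mpr hr).ne'
  set G : ℕ → Euc d → ℝ := fun n x => g n (r⁻¹ • x + -(r⁻¹ • a)) with hG
  have hGt : ∀ n, IsTestFun (G n) := fun n => (hgt n).comp_affine _ hri
  have hGs : ∀ n, tsupport (G n) ⊆ ball a r := fun n x hx => by
    rw [hG, tsupport_comp_affine (g n) _ hri] at hx
    have := tsupport_bcut_subset_ball (ht0 n) (tsupport_mul_subset_right hx)
    rwa [mem_ball_zero_iff, norm_inv_smul_sub hr, div_lt_one hr, ← mem_ball_iff_norm] at this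
  have hmolt : IsTestFun (mol (r / 2) a) := isTestFun_mol (by linarith) a
  set c : ℝ := (r ^ d)⁻¹ * r ^ 2 with hc
  have hEaff : ∀ n x, (mol (r / 2) a + c • lap (G n)) (r • x + a) =
      (r ^ d)⁻¹ * bdryErr (1 / 2) (0 : Euc d) (t n) x := fun n x => by
    have e1 := mol_comp_affine (d := d) hhalf hr a x
    rw [mul_one_div] at e1
    have e2 := lap_comp_affine (hgt n).1 r⁻¹ (-(r⁻¹ • a)) (r • x + a)
    have e3 : r⁻¹ • (r • x + a) + -(r⁻¹ • a) = x := by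
      rw [smul_add, smul_smul, inv_mul_cancel₀ hr.ne', one_smul, add_neg_cancel_right]
    rw [e3] at e2
    rw [Pi.add_apply, Pi.smul_apply, e1, smul_eq_mul, hG, e2, hc, bdryErr, Pi.add_apply]
    field_simp
    ring
  have hEt : ∀ n, IsTestFun (mol (r / 2) a + c • lap (G n)) := fun n =>
    hmolt.add ((hGt n).lap.smul c)
  have hcalc : ∀ n, ∫ ω, ((-c) * X.h 0 1 (lap (G n)) ω - X.H a r (mol (r / 2) a) ω) ^ 2 ∂X.P =
      r ^ (d + 2) * ((r ^ d)⁻¹) ^ 2 *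
        ∫ ω, X.h 0 1 (bdryErr (1 / 2) (0 : Euc d) (t n)) ω ^ 2 ∂X.P := fun n => by
    have h1 := X.integral_H_mul_H hr hD (hEt n) (hEt n)
    rw [mul_assoc, ← integral_const_mul]
    have h2 : ∫ ω, X.h 0 1 (fun x => (mol (r / 2) a + c • lap (G n)) (r • x + a)) ω *
        X.h 0 1 (fun x => (mol (r / 2) a + c • lap (G n)) (r • x + a)) ω ∂X.P =
        ∫ ω, ((r ^ d)⁻¹) ^ 2 * X.h 0 1 (bdryErr (1 / 2) (0 : Euc d) (t n)) ω ^ 2 ∂X.P := by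
      have e : (fun x => (mol (r / 2) a + c • lap (G n)) (r • x + a)) =
          (r ^ d)⁻¹ • bdryErr (1 / 2) (0 : Euc d) (t n) := funext fun x => hEaff n x
      rw [e]
      refine integral_congr_ae ?_
      filter_upwards [X.lin_smul ((r ^ d)⁻¹) _ (isTestFun_bdryErr hhalf (0 : Euc d) (ht0 n))]
        with ω hω
      rw [hω]; ring
    rw [← h2, ← h1]
    refine integral_congr_ae ?_
    filter_upwards [X.H_add hr hD hmolt ((hGt n).lap.smul c), X.H_smul hr hD c (hGt n).lap,
      X.h_ae_eq_H hr hD (hGt n) (hGs n)] with ω h3 h4 h5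
    rw [h3, Pi.add_apply, h4, Pi.smul_apply, h5, smul_eq_mul]
    ring
  refine aestronglyMeasurable_of_tendsto_sq (f := fun n ω => (-c) * X.h 0 1 (lap (G n)) ω)
    (fun n => (hmeas _ (hGt n).lap ((tsupport_lap_subset _).trans (hGs n))).const_mul (-c))
    (fun n => (MemLp.two_of_four (X.memLp_h (hGt n).lap)).const_mul (-c))
    (MemLp.two_of_four (X.memLp_H hr hD hmolt)) ?_
  simp only [hcalc]
  have := hlim.const_mul (r ^ (d + 2) * ((r ^ d)⁻¹) ^ 2)
  rwa [mul_zero] at this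

theorem aestronglyMeasurable_φharm (hd : 2 ≤ d) (hr : 0 < r) (hD : ball a r ⊆ ball 0 1)
    {b : Euc d} {ρ : ℝ}
    (hmeas : ∀ g, IsTestFun g → tsupport g ⊆ ball a r →
      AEStronglyMeasurable[X.mΦ b ρ] (X.h 0 1 g) X.P) :
    AEStronglyMeasurable[X.mΦ b ρ] (X.Φ a r (mol (r / 2) a)) X.P := by
  have hmolt : IsTestFun (mol (r / 2) a) := isTestFun_mol (by linarith) a
  have hs : tsupport (mol (r / 2) a) ⊆ ball a r :=
    (tsupport_mol (by linarith) a).trans (closedBall_subset_ball (by linarith))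
  refine ((hmeas _ hmolt hs).sub (X.aestronglyMeasurable_H_mol hd hr hD hmeas)).congr ?_
  filter_upwards [X.h_eq hr hD hmolt] with ω h1
  rw [Pi.sub_apply, h1, Pi.add_apply, add_sub_cancel_left]

end GFF

theorem ball_subset_ball_zero {w : Euc d} {ρ : ℝ} (h : ρ ≤ 1 - ‖w‖) : ball w ρ ⊆ ball 0 1 :=
  ball_subset_ball' (by rw [dist_zero_right]; linarith)

theorem tsupport_cbump_subset : tsupport (cbump : Euc d → ℝ) ⊆ closedBall 0 (7 / 8) := by
  rw [ContDiffBump.tsupport_eq]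
  exact le_rfl

namespace GFF

variable (X : GFF d Ω) {a : Euc d} {r : ℝ}

theorem integral_lap_mul_h_mul (hr : 0 < r) (hD : ball a r ⊆ ball 0 1) {g f : Euc d → ℝ}
    (hg : IsTestFun g) (hs : tsupport g ⊆ ball a r) (hf : IsTestFun f) {Y : Ω → ℝ}
    (hY : MemLp Y 2 X.P) (hYm : AEStronglyMeasurable[X.mΦ a r] Y X.P) :
    ∫ ω, X.h 0 1 (lap g) ω * (X.h 0 1 f ω * Y ω) ∂X.P =
      (∫ ω, X.H a r (lap g) ω * X.H a r f ω ∂X.P) * ∫ ω, Y ω ∂X.P := by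
  have hgH := X.memLp_H hr hD hg.lap
  have hfH := X.memLp_H hr hD hf
  have hfΦ := X.memLp_Φ hr hD hf
  have hmf := X.measurable_H_mH a r hf
  have hmg := X.measurable_H_mH a r hg.lap
  have hmΦ : AEStronglyMeasurable[X.mΦ a r] (X.Φ a r f) X.P :=
    (X.measurable_Φ_mΦ a r hf).stronglyMeasurable.aestronglyMeasurable
  have e : ∫ ω, X.h 0 1 (lap g) ω * (X.h 0 1 f ω * Y ω) ∂X.P =
      ∫ ω, ((X.H a r (lap g) * X.H a r f) ω * Y ω +
        X.H a r (lap g) ω * (X.Φ a r f * Y) ω) ∂X.P := by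
    refine integral_congr_ae ?_
    filter_upwards [X.h_ae_eq_H hr hD hg hs, X.h_eq hr hD hf] with ω h1 h2
    rw [h1, h2]
    simp only [Pi.add_apply, Pi.mul_apply]
    ring
  have i1 : Integrable (fun ω => (X.H a r (lap g) * X.H a r f) ω * Y ω) X.P :=
    (MemLp.mul_four hgH hfH).integrable_mul hY
  have i2 : Integrable (fun ω => X.H a r (lap g) ω * (X.Φ a r f * Y) ω) X.P := by
    refine ((MemLp.mul_four hgH hfΦ).integrable_mul hY).congr (ae_of_all _ fun ω => ?_)
    simp only [Pi.mul_apply]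
    ring
  rw [e, integral_add i1 i2, X.integral_mul_of_indep hr hD (hmg.mul hmf) hYm,
    X.integral_mul_of_indep hr hD hmg (hmΦ.mul hYm), X.integral_H hr hD hg.lap, zero_mul, add_zero]
  rfl

theorem integral_lap_mul_h (hr : 0 < r) (hD : ball a r ⊆ ball 0 1) {g f : Euc d → ℝ}
    (hg : IsTestFun g) (hs : tsupport g ⊆ ball a r) (hf : IsTestFun f) :
    ∫ ω, X.h 0 1 (lap g) ω * X.h 0 1 f ω ∂X.P =
      ∫ ω, X.H a r (lap g) ω * X.H a r f ω ∂X.P := by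
  simpa using X.integral_lap_mul_h_mul hr hD hg hs hf (Y := fun _ => 1) (memLp_const 1)
    aestronglyMeasurable_const

/-- The normalisation of the two-point function. -/
def twoPtConst : ℝ := -∫ ω, X.h 0 1 (lap cbump) ω * X.h 0 1 (mol (1 / 2) 0) ω ∂X.P

theorem integral_mol_mul_single (hd : 2 ≤ d) {ε : ℝ} (hε : 0 < ε) {y : Euc d} (hy : ε < 1 - ‖y‖)
    {w : Euc d} {ρ : ℝ} (hρ : 0 < ρ) (hw : ρ ≤ 1 - ‖w‖) :
    ∫ ω, X.h 0 1 (mol ε y) ω * X.h 0 1 (mol (ρ / 2) w) ω ∂X.P =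
      -X.lapPair (X.h 0 1 (mol (ρ / 2) w)) (greenPot ε y * cutoff w ρ) := by
  have hm := isTestFun_mol (d := d) (half_pos hρ) w
  have := X.integral_mol_mul hd hε hy {()} (fun _ => w) (fun _ => ρ) (fun _ _ => hρ)
    (fun _ _ => ball_subset_ball_zero hw) (fun i _ j _ hij => absurd (Subsingleton.elim i j) hij)
    (MemLp.two_of_four (X.memLp_h hm)) (fun b ρ' hρ' hb hdis =>
      X.aestronglyMeasurable_h hρ' hb hm ((hdis () (by simp)).symm.mono_left
        (tsupport_mol (half_pos hρ) w)))
  rwa [Finset.sum_singleton] at this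

theorem integral_mol_mul_mol (hd : 2 ≤ d) {ε : ℝ} (hε : 0 < ε) {y : Euc d} (hy : ε < 1 - ‖y‖)
    {w : Euc d} {ρ : ℝ} (hρ : 0 < ρ) (hw : ρ ≤ 1 - ‖w‖)
    (hdisj : Disjoint (closedBall y ε) (ball w ρ)) :
    ∫ ω, X.h 0 1 (mol ε y) ω * X.h 0 1 (mol (ρ / 2) w) ω ∂X.P =
      X.twoPtConst * greenPot ε y w := by
  set G : ℝ → Euc d → ℝ := fun r x => greenPot ε y (r • x + w) * cbump x with hG
  have hGj : ContDiff ℝ (⊤ : ℕ∞) fun p : ℝ × Euc d => G p.1 p.2 :=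
    ((contDiff_greenPot hε y).comp ((contDiff_fst.smul contDiff_snd).add contDiff_const)).mul
      (cbump.contDiff.comp contDiff_snd)
  have hGt : ∀ r, IsTestFun (G r) := fun r =>
    isTestFun_cbump.contDiff_mul ((contDiff_greenPot hε y).comp
      ((contDiff_id.const_smul r).add contDiff_const))
  have hGs : ∀ r, tsupport (lap (G r)) ⊆ closedBall 0 (7 / 8) := fun r =>
    (tsupport_lap_subset _).trans (tsupport_mul_subset_right.trans tsupport_cbump_subset)
  have hhalf : (0 : ℝ) < 1 / 2 := by norm_num
  have hm0 := isTestFun_mol (d := d) hhalf 0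
  have hyt := isTestFun_mol hε y
  have hDρ := ball_subset_ball_zero hw
  have hval : ∀ r, 0 < r → r ≤ ρ →
      ∫ ω, X.h 0 1 (lap (G r)) ω * X.h 0 1 (mol (1 / 2) 0) ω ∂X.P =
        -∫ ω, X.h 0 1 (mol ε y) ω * X.h 0 1 (mol (ρ / 2) w) ω ∂X.P := fun r hr hrρ => by
    have hmr := isTestFun_mol (d := d) (half_pos hr) w
    have hmρ := isTestFun_mol (d := d) (half_pos hρ) w
    have hDr : ball w r ⊆ ball 0 1 := (ball_subset_ball hrρ).trans hDρ
    have e1 : ∫ ω, X.h 0 1 (mol ε y) ω * X.h 0 1 (mol (ρ / 2) w) ω ∂X.P =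
        ∫ ω, X.h 0 1 (mol ε y) ω * X.h 0 1 (mol (r / 2) w) ω ∂X.P := by
      obtain ⟨g, hg, hgs, hge⟩ := exists_lap_eq_mol_sub (d := d) (half_pos hρ) (half_pos hr)
        (half_lt_self hρ) (by linarith) w
      have h0 := X.integral_lap_mul_eq_zero hρ hDρ hg hgs (X.aestronglyMeasurable_h hρ hDρ hyt
        (hdisj.mono_left (tsupport_mol hε y)))
      have h1 : X.h 0 1 (mol (ρ / 2) w) =ᵐ[X.P] X.h 0 1 (lap g) + X.h 0 1 (mol (r / 2) w) := by
        have := X.lin_add _ _ hg.lap hmr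
        rw [hge, sub_add_cancel, ← hge] at this
        exact this
      have h2 : ∫ ω, X.h 0 1 (mol ε y) ω * X.h 0 1 (mol (ρ / 2) w) ω ∂X.P =
          ∫ ω, (X.h 0 1 (lap g) ω * X.h 0 1 (mol ε y) ω +
            X.h 0 1 (mol ε y) ω * X.h 0 1 (mol (r / 2) w) ω) ∂X.P := by
        refine integral_congr_ae ?_
        filter_upwards [h1] with ω hω
        rw [hω, Pi.add_apply]
        ring
      rw [h2, integral_add (X.integrable_h_mul hg.lap (MemLp.two_of_four (X.memLp_h hyt)))
        (X.integrable_h_mul hyt (MemLp.two_of_four (X.memLp_h hmr))), h0, zero_add]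
    have hgt : IsTestFun (greenPot ε y * cutoff w r) :=
      (isTestFun_cutoff _ hr).contDiff_mul (contDiff_greenPot hε y)
    have hgs : tsupport (greenPot ε y * cutoff w r) ⊆ ball w r :=
      tsupport_mul_subset_right.trans ((tsupport_cutoff_subset w hr).trans
        (closedBall_subset_ball (by linarith)))
    rw [e1, X.integral_mol_mul_single hd hε hy hr (hrρ.trans hw), lapPair,
      X.integral_lap_mul_h hr hDr hgt hgs hmr, X.integral_H_mul_H hr hDr hgt.lap hmr, neg_neg,
      ← integral_const_mul]
    have a1 : (fun x => lap (greenPot ε y * cutoff w r) (r • x + w)) = (r ^ 2)⁻¹ • lap (G r) := by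
      ext x
      have := lap_comp_affine hgt.1 r w x
      have e : (fun x => (greenPot ε y * cutoff w r) (r • x + w)) = G r := by
        ext x
        rw [Pi.mul_apply, cutoff_comp_affine w hr]
      rw [e] at this
      rw [Pi.smul_apply, this, smul_eq_mul, inv_mul_cancel_left₀ (by positivity)]
    have a2 : (fun x => mol (r / 2) w (r • x + w)) = (r ^ d)⁻¹ • mol (1 / 2) 0 := by
      ext x
      have := mol_comp_affine (d := d) hhalf hr w x
      rw [mul_one_div] at this
      rw [this, Pi.smul_apply, smul_eq_mul]
    rw [a1, a2]
    refine integral_congr_ae ?_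
    filter_upwards [X.lin_smul (r ^ 2)⁻¹ _ (hGt r).lap, X.lin_smul (r ^ d)⁻¹ _ hm0] with ω h1 h2
    rw [h1, h2, pow_add]
    field_simp
  have hrn : Tendsto (fun n : ℕ => ρ / ((n : ℝ) + 1)) atTop (𝓝 0) :=
    tendsto_const_div_atTop_nhds_zero_nat ρ |>.comp (tendsto_add_atTop_nat 1) |>.congr fun n => by
      simp
  have hlim := X.K2_cont (fun n : ℕ => lap (G (ρ / ((n : ℝ) + 1)))) (lap (G 0)) (mol (1 / 2) 0)
    (closedBall 0 (7 / 8)) (isCompact_closedBall _ _) (closedBall_subset_ball (by norm_num))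
    (fun n => (hGt _).lap) (hGt 0).lap hm0
    ((tsupport_mol hhalf 0).trans (closedBall_subset_ball (by norm_num)))
    (fun n => hGs _) (hGs 0)
    (tendstoUniformly_iteratedFDeriv (contDiff_lap_joint hGj) (isCompact_closedBall _ _) hGs hrn)
  have hc : ∀ n : ℕ, ∫ ω, X.h 0 1 (lap (G (ρ / ((n : ℝ) + 1)))) ω * X.h 0 1 (mol (1 / 2) 0) ω ∂X.P =
      -∫ ω, X.h 0 1 (mol ε y) ω * X.h 0 1 (mol (ρ / 2) w) ω ∂X.P := fun n =>
    hval _ (by positivity) (div_le_self hρ.le (by linarith [(Nat.cast_nonneg n : (0 : ℝ) ≤ n)]))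
  simp only [hc] at hlim
  have hG0 : lap (G 0) = greenPot ε y w • lap cbump := by
    rw [← lap_smul isTestFun_cbump.1]
    congr 1
    ext x
    simp [hG]
  have h3 : ∫ ω, X.h 0 1 (lap (G 0)) ω * X.h 0 1 (mol (1 / 2) 0) ω ∂X.P =
      -(X.twoPtConst * greenPot ε y w) := by
    rw [twoPtConst, neg_mul, neg_neg, mul_comm, ← integral_const_mul, hG0]
    refine integral_congr_ae ?_
    filter_upwards [X.lin_smul (greenPot ε y w) _ isTestFun_cbump.lap] with ω hω
    rw [hω, mul_assoc]
  have h4 := tendsto_nhds_unique hlim tendsto_const_nhds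
  linarith

end GFF

/-- Truncation at level `K`. -/
def clip (K x : ℝ) : ℝ := max (-K) (min K x)

theorem continuous_clip (K : ℝ) : Continuous (clip K) :=
  continuous_const.max (continuous_const.min continuous_id)

theorem abs_clip_le_left {K : ℝ} (hK : 0 ≤ K) (x : ℝ) : |clip K x| ≤ K :=
  abs_le.mpr ⟨le_max_left _ _, max_le (by linarith) (min_le_left _ _)⟩

theorem clip_of_abs_le {K x : ℝ} (h : |x| ≤ K) : clip K x = x := by
  obtain ⟨h1, h2⟩ := abs_le.mp h
  rw [clip, min_eq_right h2, max_eq_right h1]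

theorem abs_clip_le_right {K : ℝ} (hK : 0 ≤ K) (x : ℝ) : |clip K x| ≤ |x| := by
  rcases le_total |x| K with h | h
  · rw [clip_of_abs_le h]
  · exact (abs_clip_le_left hK x).trans h

namespace GFF

variable (X : GFF d Ω) {a : Euc d} {r : ℝ}

theorem tendsto_integral_h_mul_clip {f : Euc d → ℝ} {Y : Ω → ℝ}
    (hYm : AEStronglyMeasurable Y X.P) (hY : Integrable (fun ω => X.h 0 1 f ω * Y ω) X.P) :
    Tendsto (fun n : ℕ => ∫ ω, X.h 0 1 f ω * clip n (Y ω) ∂X.P) atTop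
      (𝓝 (∫ ω, X.h 0 1 f ω * Y ω ∂X.P)) := by
  refine tendsto_integral_of_dominated_convergence (fun ω => ‖X.h 0 1 f ω * Y ω‖)
    (fun n => (X.meas_h 0 1 f).aestronglyMeasurable.mul
      ((continuous_clip n).comp_aestronglyMeasurable hYm)) hY.norm
    (fun n => ae_of_all _ fun ω => ?_) (ae_of_all _ fun ω => ?_)
  · rw [norm_mul, norm_mul]
    gcongr
    exact abs_clip_le_right n.cast_nonneg _
  · refine tendsto_const_nhds.congr' ?_
    obtain ⟨N, hN⟩ := exists_nat_ge |Y ω|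
    filter_upwards [eventually_ge_atTop N] with n hn
    rw [clip_of_abs_le (hN.trans (Nat.cast_le.mpr hn))]

/-- Integration by parts for random variables with few moments. -/
theorem integral_mol_mul_of_integrable (hd : 2 ≤ d) {ε : ℝ} (hε : 0 < ε) {y : Euc d}
    (hy : ε < 1 - ‖y‖) {ι : Type*} (s : Finset ι) (z : ι → Euc d) (a : ι → ℝ)
    (ha : ∀ j ∈ s, 0 < a j) (hball : ∀ j ∈ s, ball (z j) (a j) ⊆ ball 0 1)
    (hdisj : ∀ i ∈ s, ∀ j ∈ s, i ≠ j → Disjoint (ball (z i) (a i)) (ball (z j) (a j)))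
    {Y : Ω → ℝ} (hY0 : AEStronglyMeasurable Y X.P)
    (hY : ∀ f, IsTestFun f → Integrable (fun ω => X.h 0 1 f ω * Y ω) X.P)
    (hYm : ∀ b ρ, 0 < ρ → ball b ρ ⊆ ball 0 1 →
      (∀ j ∈ s, Disjoint (ball b ρ) (closedBall (z j) (a j / 2))) →
      AEStronglyMeasurable[X.mΦ b ρ] Y X.P) :
    ∫ ω, X.h 0 1 (mol ε y) ω * Y ω ∂X.P =
      -∑ j ∈ s, X.lapPair Y (greenPot ε y * cutoff (z j) (a j)) := by
  have h1 := X.tendsto_integral_h_mul_clip hY0 (hY _ (isTestFun_mol hε y))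
  have h2 : Tendsto (fun n : ℕ => -∑ j ∈ s, X.lapPair (fun ω => clip n (Y ω))
      (greenPot ε y * cutoff (z j) (a j))) atTop
      (𝓝 (-∑ j ∈ s, X.lapPair Y (greenPot ε y * cutoff (z j) (a j)))) := by
    refine (tendsto_finsetSum _ fun j hj => ?_).neg
    exact X.tendsto_integral_h_mul_clip hY0 (hY _
      ((isTestFun_cutoff _ (ha j hj)).contDiff_mul (contDiff_greenPot hε y)).lap)
  refine tendsto_nhds_unique h1 (h2.congr fun n => Eq.symm ?_)
  refine X.integral_mol_mul hd hε hy s z a ha hball hdisj ?_ fun b ρ hρ hb hj =>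
    (continuous_clip n).comp_aestronglyMeasurable (hYm b ρ hρ hb hj)
  exact MemLp.of_bound ((continuous_clip n).comp_aestronglyMeasurable hY0) n
    (ae_of_all _ fun ω => abs_clip_le_left n.cast_nonneg _)

theorem integrable_mul_three {P : Measure Ω} {A B C D : Ω → ℝ} (hA : MemLp A 4 P)
    (hB : MemLp B 4 P) (hC : MemLp C 4 P) (hD : MemLp D 4 P) :
    Integrable (fun ω => A ω * (B ω * (C ω * D ω))) P := by
  refine ((MemLp.mul_four hA hB).integrable_mul (MemLp.mul_four hC hD)).congr
    (ae_of_all _ fun ω => ?_)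
  simp only [Pi.mul_apply]
  ring

theorem integral_h_mul_three (hr : 0 < r) (hD : ball a r ⊆ ball 0 1) {f : Euc d → ℝ}
    (hf : IsTestFun f) {A B C : Ω → ℝ} (hA : MemLp A 4 X.P) (hB : MemLp B 4 X.P)
    (hC : MemLp C 4 X.P) (hAm : AEStronglyMeasurable[X.mΦ a r] A X.P)
    (hBm : AEStronglyMeasurable[X.mΦ a r] B X.P) (hCm : AEStronglyMeasurable[X.mΦ a r] C X.P) :
    ∫ ω, X.h 0 1 f ω * (A ω * (B ω * C ω)) ∂X.P =
      ∫ ω, X.Φ a r f ω * (A ω * (B ω * C ω)) ∂X.P := by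
  have e : ∫ ω, X.h 0 1 f ω * (A ω * (B ω * C ω)) ∂X.P =
      ∫ ω, (X.H a r f ω * (A ω * (B ω * C ω)) + X.Φ a r f ω * (A ω * (B ω * C ω))) ∂X.P := by
    refine integral_congr_ae ?_
    filter_upwards [X.h_eq hr hD hf] with ω hω
    rw [hω, Pi.add_apply, add_mul]
  rw [e, integral_add (integrable_mul_three (X.memLp_H hr hD hf) hA hB hC)
    (integrable_mul_three (X.memLp_Φ hr hD hf) hA hB hC),
    X.integral_mul_of_indep hr hD (X.measurable_H_mH a r hf)
      (Y := fun ω => A ω * (B ω * C ω)) (hAm.mul (hBm.mul hCm)),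
    X.integral_H hr hD hf, zero_mul, zero_add]

/-- The field tested against the mollifier at one of finitely many points. -/
abbrev ptVal {ι : Type*} (z : ι → Euc d) (a : ι → ℝ) (i : ι) : Ω → ℝ :=
  X.h 0 1 (mol (a i / 2) (z i))

/-- The harmonic part tested against the mollifier at one of finitely many points. -/
abbrev ptHarm {ι : Type*} (z : ι → Euc d) (a : ι → ℝ) (i : ι) : Ω → ℝ :=
  X.Φ (z i) (a i) (mol (a i / 2) (z i))

end GFF

/-- Points with pairwise disjoint balls around them inside the unit ball. -/
structure PtConfig {ι : Type*} (z : ι → Euc d) (a : ι → ℝ) : Prop where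
  pos : ∀ i, 0 < a i
  le : ∀ i, a i ≤ 1 - ‖z i‖
  disj : ∀ i j, i ≠ j → Disjoint (ball (z i) (a i)) (ball (z j) (a j))

namespace PtConfig

variable {ι : Type*} {z : ι → Euc d} {a : ι → ℝ} (X : GFF d Ω)

theorem ball_subset (hc : PtConfig z a) (i : ι) : ball (z i) (a i) ⊆ ball 0 1 :=
  ball_subset_ball_zero (hc.le i)

theorem isTestFun (hc : PtConfig z a) (i : ι) : IsTestFun (mol (a i / 2) (z i)) :=
  isTestFun_mol (half_pos (hc.pos i)) _

theorem tsupport_subset (hc : PtConfig z a) (i : ι) :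
    tsupport (mol (a i / 2) (z i)) ⊆ closedBall (z i) (a i / 2) :=
  tsupport_mol (half_pos (hc.pos i)) _

theorem tsupport_subset_ball (hc : PtConfig z a) (i : ι) :
    tsupport (mol (a i / 2) (z i)) ⊆ ball (z i) (a i) :=
  (hc.tsupport_subset i).trans (closedBall_subset_ball (half_lt_self (hc.pos i)))

theorem memLp_ptVal (hc : PtConfig z a) (i : ι) : MemLp (X.ptVal z a i) 4 X.P :=
  X.memLp_h (hc.isTestFun i)

theorem memLp_ptHarm (hc : PtConfig z a) (i : ι) : MemLp (X.ptHarm z a i) 4 X.P :=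
  X.memLp_Φ (hc.pos i) (hc.ball_subset i) (hc.isTestFun i)

theorem aestronglyMeasurable_ptVal (hc : PtConfig z a) {b : Euc d} {ρ : ℝ} (hρ : 0 < ρ)
    (hb : ball b ρ ⊆ ball 0 1) (i : ι) (h : Disjoint (ball b ρ) (closedBall (z i) (a i / 2))) :
    AEStronglyMeasurable[X.mΦ b ρ] (X.ptVal z a i) X.P :=
  X.aestronglyMeasurable_h hρ hb (hc.isTestFun i) (h.symm.mono_left (hc.tsupport_subset i))

theorem aestronglyMeasurable_ptVal_of_ne (hc : PtConfig z a) {i j : ι} (h : i ≠ j) :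
    AEStronglyMeasurable[X.mΦ (z j) (a j)] (X.ptVal z a i) X.P :=
  X.aestronglyMeasurable_h (hc.pos j) (hc.ball_subset j) (hc.isTestFun i)
    ((hc.disj i j h).mono_left (hc.tsupport_subset_ball i))

theorem aestronglyMeasurable_ptHarm_of_ne (hc : PtConfig z a) (hd : 2 ≤ d) {i j : ι} (h : i ≠ j) :
    AEStronglyMeasurable[X.mΦ (z j) (a j)] (X.ptHarm z a i) X.P :=
  X.aestronglyMeasurable_φharm hd (hc.pos i) (hc.ball_subset i) fun _ hg hs =>
    X.aestronglyMeasurable_h (hc.pos j) (hc.ball_subset j) hg ((hc.disj i j h).mono_left hs)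

theorem integral_ptVal_mul (hc : PtConfig z a) (hd : 2 ≤ d) {i j : ι} (h : i ≠ j) :
    ∫ ω, X.ptVal z a i ω * X.ptVal z a j ω ∂X.P =
      X.twoPtConst * greenPot (a i / 2) (z i) (z j) :=
  X.integral_mol_mul_mol hd (half_pos (hc.pos i)) (by linarith [hc.pos i, hc.le i]) (hc.pos j)
    (hc.le j) ((hc.disj i j h).mono_left (closedBall_subset_ball (half_lt_self (hc.pos i))))

/-- One term of the integration by parts factorises. -/
theorem lapPair_ptVal (hc : PtConfig z a) (hd : 2 ≤ d) {i j k l : ι} (hjk : k ≠ j)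
    (hjl : l ≠ j) :
    X.lapPair (fun ω => X.ptVal z a j ω * (X.ptVal z a k ω * X.ptVal z a l ω))
      (greenPot (a i / 2) (z i) * cutoff (z j) (a j)) =
      -(∫ ω, X.ptVal z a i ω * X.ptVal z a j ω ∂X.P) *
        ∫ ω, X.ptVal z a k ω * X.ptVal z a l ω ∂X.P := by
  have hi := half_pos (hc.pos i)
  have hg : IsTestFun (greenPot (a i / 2) (z i) * cutoff (z j) (a j)) :=
    (isTestFun_cutoff _ (hc.pos j)).contDiff_mul (contDiff_greenPot hi _)
  have hs : tsupport (greenPot (a i / 2) (z i) * cutoff (z j) (a j)) ⊆ ball (z j) (a j) :=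
    tsupport_mul_subset_right.trans ((tsupport_cutoff_subset _ (hc.pos j)).trans
      (closedBall_subset_ball (by linarith [hc.pos j])))
  rw [X.integral_mol_mul_single hd hi (by linarith [hc.pos i, hc.le i]) (hc.pos j) (hc.le j),
    neg_neg, GFF.lapPair, GFF.lapPair,
    X.integral_lap_mul_h (hc.pos j) (hc.ball_subset j) hg hs (hc.isTestFun j)]
  exact X.integral_lap_mul_h_mul (hc.pos j) (hc.ball_subset j) hg hs (hc.isTestFun j)
    (Y := fun ω => X.ptVal z a k ω * X.ptVal z a l ω)
    (MemLp.mul_four (hc.memLp_ptVal X k) (hc.memLp_ptVal X l))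
    ((hc.aestronglyMeasurable_ptVal_of_ne X hjk).mul (hc.aestronglyMeasurable_ptVal_of_ne X hjl))

end PtConfig

namespace PtConfig

variable {z : Fin 4 → Euc d} {a : Fin 4 → ℝ} (X : GFF d Ω)

/-- Wick's formula for the mollified field. -/
theorem integral_ptVal_four (hc : PtConfig z a) (hd : 2 ≤ d) :
    ∫ ω, X.ptVal z a 0 ω * (X.ptVal z a 1 ω * (X.ptVal z a 2 ω * X.ptVal z a 3 ω)) ∂X.P =
      (∫ ω, X.ptVal z a 0 ω * X.ptVal z a 1 ω ∂X.P) *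
          (∫ ω, X.ptVal z a 2 ω * X.ptVal z a 3 ω ∂X.P) +
        (∫ ω, X.ptVal z a 0 ω * X.ptVal z a 2 ω ∂X.P) *
          (∫ ω, X.ptVal z a 1 ω * X.ptVal z a 3 ω ∂X.P) +
        (∫ ω, X.ptVal z a 0 ω * X.ptVal z a 3 ω ∂X.P) *
          (∫ ω, X.ptVal z a 1 ω * X.ptVal z a 2 ω ∂X.P) := by
  have h1 := hc.memLp_ptVal X 1
  have h2 := hc.memLp_ptVal X 2
  have h3 := hc.memLp_ptVal X 3
  have hcore := X.integral_mol_mul_of_integrable hd (half_pos (hc.pos 0)) (y := z 0)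
    (by linarith [hc.pos 0, hc.le 0]) ({1, 2, 3} : Finset (Fin 4)) z a (fun j _ => hc.pos j)
    (fun j _ => hc.ball_subset j) (fun i _ j _ => hc.disj i j)
    (Y := fun ω => X.ptVal z a 1 ω * (X.ptVal z a 2 ω * X.ptVal z a 3 ω))
    (h1.1.mul (h2.1.mul h3.1))
    (fun f hf => GFF.integrable_mul_three (X.memLp_h hf) h1 h2 h3)
    (fun b ρ hρ hb hj => (hc.aestronglyMeasurable_ptVal X hρ hb 1 (hj 1 (by simp))).mul
      ((hc.aestronglyMeasurable_ptVal X hρ hb 2 (hj 2 (by simp))).mul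
        (hc.aestronglyMeasurable_ptVal X hρ hb 3 (hj 3 (by simp)))))
  have t1 := hc.lapPair_ptVal X hd (i := 0) (j := 1) (k := 2) (l := 3) (by decide) (by decide)
  have t2 := hc.lapPair_ptVal X hd (i := 0) (j := 2) (k := 1) (l := 3) (by decide) (by decide)
  have t3 := hc.lapPair_ptVal X hd (i := 0) (j := 3) (k := 1) (l := 2) (by decide) (by decide)
  have e2 : (fun ω => X.ptVal z a 2 ω * (X.ptVal z a 1 ω * X.ptVal z a 3 ω)) =
      fun ω => X.ptVal z a 1 ω * (X.ptVal z a 2 ω * X.ptVal z a 3 ω) := by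
    ext ω; ring
  have e3 : (fun ω => X.ptVal z a 3 ω * (X.ptVal z a 1 ω * X.ptVal z a 2 ω)) =
      fun ω => X.ptVal z a 1 ω * (X.ptVal z a 2 ω * X.ptVal z a 3 ω) := by
    ext ω; ring
  rw [e2] at t2
  rw [e3] at t3
  rw [Finset.sum_insert (by decide), Finset.sum_insert (by decide), Finset.sum_singleton,
    t1, t2, t3] at hcore
  rw [hcore]
  ring

theorem integral_ptHarm_four (hc : PtConfig z a) (hd : 2 ≤ d) :
    ∫ ω, X.ptHarm z a 0 ω * (X.ptHarm z a 1 ω * (X.ptHarm z a 2 ω * X.ptHarm z a 3 ω)) ∂X.P =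
      ∫ ω, X.ptVal z a 0 ω * (X.ptVal z a 1 ω * (X.ptVal z a 2 ω * X.ptVal z a 3 ω)) ∂X.P := by
  have V := hc.memLp_ptVal X
  have U := hc.memLp_ptHarm X
  have MV := fun (i j : Fin 4) (h : i ≠ j) => hc.aestronglyMeasurable_ptVal_of_ne X h
  have MU := fun (i j : Fin 4) (h : i ≠ j) => hc.aestronglyMeasurable_ptHarm_of_ne X hd h
  have s0 := X.integral_h_mul_three (hc.pos 0) (hc.ball_subset 0) (hc.isTestFun 0)
    (V 1) (V 2) (V 3) (MV 1 0 (by decide)) (MV 2 0 (by decide)) (MV 3 0 (by decide))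
  have s1 := X.integral_h_mul_three (hc.pos 1) (hc.ball_subset 1) (hc.isTestFun 1)
    (U 0) (V 2) (V 3) (MU 0 1 (by decide)) (MV 2 1 (by decide)) (MV 3 1 (by decide))
  have s2 := X.integral_h_mul_three (hc.pos 2) (hc.ball_subset 2) (hc.isTestFun 2)
    (U 0) (U 1) (V 3) (MU 0 2 (by decide)) (MU 1 2 (by decide)) (MV 3 2 (by decide))
  have s3 := X.integral_h_mul_three (hc.pos 3) (hc.ball_subset 3) (hc.isTestFun 3)
    (U 0) (U 1) (U 2) (MU 0 3 (by decide)) (MU 1 3 (by decide)) (MU 2 3 (by decide))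
  have c1 : ∀ p q u v : ℝ, p * (q * (u * v)) = q * (p * (u * v)) := fun p q u v => by ring
  have c2 : ∀ p q u v : ℝ, p * (q * (u * v)) = u * (p * (q * v)) := fun p q u v => by ring
  have c3 : ∀ p q u v : ℝ, p * (q * (u * v)) = v * (p * (q * u)) := fun p q u v => by ring
  calc _ = _ := integral_congr_ae (ae_of_all _ fun ω => c3 _ _ _ _)
    _ = _ := s3.symm
    _ = _ := integral_congr_ae (ae_of_all _ fun ω => (c3 _ _ _ _).symm)
    _ = _ := integral_congr_ae (ae_of_all _ fun ω => c2 _ _ _ _)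
    _ = _ := s2.symm
    _ = _ := integral_congr_ae (ae_of_all _ fun ω => (c2 _ _ _ _).symm)
    _ = _ := integral_congr_ae (ae_of_all _ fun ω => c1 _ _ _ _)
    _ = _ := s1.symm
    _ = _ := integral_congr_ae (ae_of_all _ fun ω => (c1 _ _ _ _).symm)
    _ = _ := s0.symm

end PtConfig

theorem ptConfig_k4eps {z : Fin 4 → Euc d} (hz : ∀ i, ‖z i‖ < 1) (hinj : Function.Injective z) :
    PtConfig z (k4eps z) := by
  have hd2 : ∀ i j, j ≠ i → k4eps z i ≤ dist (z i) (z j) / 4 := fun i j hij => by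
    have h1 : ⨅ j : {j : Fin 4 // j ≠ i}, dist (z i) (z j.1) ≤ dist (z i) (z j) :=
      ciInf_le (Set.finite_range fun j : {j : Fin 4 // j ≠ i} => dist (z i) (z j.1)).bddBelow
        ⟨j, hij⟩
    have h2 := min_le_left ((⨅ j : {j : Fin 4 // j ≠ i}, dist (z i) (z j.1)) / 2) (1 - ‖z i‖)
    rw [k4eps]
    linarith
  have hpos : ∀ i, 0 < k4eps z i := fun i => by
    have : Nonempty {j : Fin 4 // j ≠ i} := ⟨⟨i + 1, by fin_cases i <;> decide⟩⟩
    obtain ⟨j, hj⟩ := exists_eq_ciInf_of_finite (f := fun j : {j : Fin 4 // j ≠ i} =>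
      dist (z i) (z j.1))
    rw [k4eps, ← hj]
    have h1 : 0 < dist (z i) (z j.1) := dist_pos.mpr fun h => j.2 (hinj h).symm
    exact half_pos (lt_min (half_pos h1) (by linarith [hz i]))
  refine ⟨hpos, fun i => ?_, fun i j hij => ball_disjoint_ball ?_⟩
  · have h2 := min_le_right ((⨅ j : {j : Fin 4 // j ≠ i}, dist (z i) (z j.1)) / 2) (1 - ‖z i‖)
    rw [k4eps]
    linarith [hz i]
  · have h1 := hd2 i j hij.symm
    have h2 := hd2 j i hij
    rw [dist_comm] at h2
    linarith [dist_nonneg (x := z i) (y := z j)]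

theorem GFF.molMass_mul_k4 (X : GFF d Ω) {z : Fin 4 → Euc d} (hc : PtConfig z (k4eps z)) :
    molMass d ^ 4 * X.k4 z = ∫ ω, X.ptHarm z (k4eps z) 0 ω * (X.ptHarm z (k4eps z) 1 ω *
      (X.ptHarm z (k4eps z) 2 ω * X.ptHarm z (k4eps z) 3 ω)) ∂X.P := by
  rw [GFF.k4, ← integral_const_mul]
  refine integral_congr_ae ?_
  have h := fun i => X.φharm_ae (hc.pos i) (hc.ball_subset i)
  filter_upwards [h 0, h 1, h 2, h 3] with ω h0 h1 h2 h3
  rw [GFF.ptHarm, GFF.ptHarm, GFF.ptHarm, GFF.ptHarm, ← h0, ← h1, ← h2, ← h3, Fin.prod_univ_four]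
  ring

end

/-- the Wick-type bound for the four-point function on spheres near the
boundary. -/
theorem statement11 (d : ℕ) (hd : 2 ≤ d) (Ω : Type) [MeasurableSpace Ω] (X : GFF d Ω) :
    ∃ c : ℝ, ∃ η : ℝ, 0 ≤ η ∧ η < 1 ∧
      ∀ δ : ℝ, δ ∈ Set.Ioc (0 : ℝ) 1 →
        ∀ z : Fin 4 → Euc d, (∀ i, ‖z i‖ = 1 - δ) → Function.Injective z →
          |X.k4 z| ≤ c * δ ^ (-η) *
            (greenBall d (z 0) (z 1) * greenBall d (z 2) (z 3) +
              greenBall d (z 0) (z 2) * greenBall d (z 1) (z 3) +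
              greenBall d (z 0) (z 3) * greenBall d (z 1) (z 2)) := by
  obtain ⟨κ, hκ, hκeq⟩ := exists_greenPot_eq hd
  have hm := molMass_pos hd
  refine ⟨(X.twoPtConst * κ) ^ 2 / molMass d ^ 4, 0, le_rfl, one_pos, fun δ hδ z hz hinj => ?_⟩
  have hz1 : ∀ i, ‖z i‖ < 1 := fun i => by rw [hz i]; linarith [hδ.1]
  have hc := ptConfig_k4eps hz1 hinj
  have hG : ∀ i j, i ≠ j → greenPot (k4eps z i / 2) (z i) (z j) = κ * greenBall d (z i) (z j) :=
    fun i j hij => by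
      have hp := hc.pos i
      refine hκeq _ _ _ (half_pos hp) (by linarith [hc.le i]) ?_ (hz1 j)
      by_contra h
      refine Set.disjoint_left.mp (hc.disj i j hij) ?_ (mem_ball_self (hc.pos j))
      rw [mem_ball_iff_norm]
      linarith
  have hG0 : ∀ i j, i ≠ j → 0 ≤ greenBall d (z i) (z j) := fun i j hij => by
    have h := greenPot_nonneg (half_pos (hc.pos i)) (hz1 j).le (hz1 i).le
    rw [hG i j hij] at h
    exact nonneg_of_mul_nonneg_right h hκ
  have hV : ∀ i j, i ≠ j → ∫ ω, X.ptVal z (k4eps z) i ω * X.ptVal z (k4eps z) j ω ∂X.P =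
      X.twoPtConst * (κ * greenBall d (z i) (z j)) := fun i j hij => by
    rw [hc.integral_ptVal_mul X hd hij, hG i j hij]
  have hk := X.molMass_mul_k4 hc
  rw [hc.integral_ptHarm_four X hd, hc.integral_ptVal_four X hd, hV 0 1 (by decide),
    hV 2 3 (by decide), hV 0 2 (by decide), hV 1 3 (by decide), hV 0 3 (by decide),
    hV 1 2 (by decide)] at hk
  have g1 := mul_nonneg (hG0 0 1 (by decide)) (hG0 2 3 (by decide))
  have g2 := mul_nonneg (hG0 0 2 (by decide)) (hG0 1 3 (by decide))
  have g3 := mul_nonneg (hG0 0 3 (by decide)) (hG0 1 2 (by decide))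
  have hk2 : X.k4 z = (X.twoPtConst * κ) ^ 2 / molMass d ^ 4 *
      (greenBall d (z 0) (z 1) * greenBall d (z 2) (z 3) +
        greenBall d (z 0) (z 2) * greenBall d (z 1) (z 3) +
        greenBall d (z 0) (z 3) * greenBall d (z 1) (z 2)) := by
    rw [div_mul_eq_mul_div, eq_div_iff (by positivity), mul_comm, hk]
    ring
  rw [neg_zero, Real.rpow_zero, mul_one, hk2, abs_of_nonneg (by positivity)]
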